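/- Let n ≥ 2, let Q = 2n + 2 (so Q > 4), let 0 ≤ s ≤ 2, and let R > 0. Set B = {(z, t) ∈ ℝ^{2n+1} : ρ(z, t) < R}. Then there exists a constant C > 0 such that for every real-valued φ ∈ C_c^∞ with support contained in B \ {0}, the Rellich–Sobolev type inequality holds: ∫_B (ρ²/|z|²) |Δ_ℍ φ|² dz dt ≥ C ( ∫_B (|z|^{2s−2}/ρ^{4s−2}) |φ|^{2(Q−2s)/(Q−4)} dz dt )^{(Q−4)/(Q−2s)}. -/

import Mathlib

open MeasureTheory Real

noncomputable section

/-- The underlying space of the Heisenberg group ℍⁿ, identified with ℝ^{2n+1}: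
points `(x, y, t)` with `x y : Fin n → ℝ`, `t : ℝ`; write `z = (x, y)`. -/
abbrev Hspace (n : ℕ) : Type := (Fin n → ℝ) × (Fin n → ℝ) × ℝ

/-- The horizontal vector field `X_j f = ∂f/∂x_j + 2 y_j ∂f/∂t`. -/
def Xd (n : ℕ) (j : Fin n) (f : Hspace n → ℝ) (p : Hspace n) : ℝ :=
  fderiv ℝ f p (Pi.single j 1, 0, 0) + 2 * p.2.1 j * fderiv ℝ f p (0, 0, 1)

/-- The horizontal vector field `Y_j f = ∂f/∂y_j − 2 x_j ∂f/∂t`. -/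
def Yd (n : ℕ) (j : Fin n) (f : Hspace n → ℝ) (p : Hspace n) : ℝ :=
  fderiv ℝ f p (0, Pi.single j 1, 0) - 2 * p.1 j * fderiv ℝ f p (0, 0, 1)

/-- Squared length of the horizontal gradient: `|∇_ℍ f|² = Σ_j ((X_j f)² + (Y_j f)²)`. -/
def gradH2 (n : ℕ) (f : Hspace n → ℝ) (p : Hspace n) : ℝ :=
  ∑ j : Fin n, ((Xd n j f p) ^ 2 + (Yd n j f p) ^ 2)

/-- The Kohn sub-Laplacian `Δ_ℍ f = Σ_j (X_j(X_j f) + Y_j(Y_j f))`. -/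
def lapH (n : ℕ) (f : Hspace n → ℝ) (p : Hspace n) : ℝ :=
  ∑ j : Fin n, (Xd n j (Xd n j f) p + Yd n j (Yd n j f) p)

/-- `|z|² = |x|² + |y|²`. -/
def zSq (n : ℕ) (p : Hspace n) : ℝ := ∑ j : Fin n, ((p.1 j) ^ 2 + (p.2.1 j) ^ 2)

/-- The homogeneous norm `ρ(z, t) = (|z|⁴ + t²)^{1/4}`. -/
def rho (n : ℕ) (p : Hspace n) : ℝ := ((zSq n p) ^ 2 + p.2.2 ^ 2) ^ ((4 : ℝ)⁻¹)

/-- The horizontal vector field with constant coefficients `a`, `b`. -/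
def Vf (n : ℕ) (a b : Fin n → ℝ) (p : Hspace n) : Hspace n :=
  (a, b, 2 * ∑ j, (p.2.1 j * a j - p.1 j * b j))

lemma Vf_X (n : ℕ) (j : Fin n) (p : Hspace n) :
    Vf n (Pi.single j 1) 0 p = (Pi.single j 1, 0, 2 * p.2.1 j) := by
  simp [Vf, Pi.single_apply]

lemma Vf_Y (n : ℕ) (j : Fin n) (p : Hspace n) :
    Vf n 0 (Pi.single j 1) p = (0, Pi.single j 1, -(2 * p.1 j)) := by
  simp [Vf, Pi.single_apply]

lemma Xd_eq (n : ℕ) (j : Fin n) (f : Hspace n → ℝ) (p : Hspace n) :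
    Xd n j f p = fderiv ℝ f p (Vf n (Pi.single j 1) 0 p) := by
  rw [Vf_X, Xd]
  have : ((Pi.single j 1, 0, 2 * p.2.1 j) : Hspace n) =
    (Pi.single j 1, 0, 0) + (2 * p.2.1 j) • ((0, 0, 1) : Hspace n) := by
    simp
  rw [this, map_add, map_smul, smul_eq_mul]

lemma Yd_eq (n : ℕ) (j : Fin n) (f : Hspace n → ℝ) (p : Hspace n) :
    Yd n j f p = fderiv ℝ f p (Vf n 0 (Pi.single j 1) p) := by
  rw [Vf_Y, Yd]
  have : ((0, Pi.single j 1, -(2 * p.1 j)) : Hspace n) =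
    (0, Pi.single j 1, 0) + (-(2 * p.1 j)) • ((0, 0, 1) : Hspace n) := by
    simp
  rw [this, map_add, map_smul, smul_eq_mul]; ring

lemma fderiv_Vf (n : ℕ) (a b : Fin n → ℝ) (f : Hspace n → ℝ) (p : Hspace n) :
    fderiv ℝ f p (Vf n a b p) = ∑ j, (a j * Xd n j f p + b j * Yd n j f p) := by
  have h : Vf n a b p = ∑ j, (a j • Vf n (Pi.single j 1) 0 p + b j • Vf n 0 (Pi.single j 1) p) := by
    simp_rw [Vf_X, Vf_Y]
    ext k
    · simp [Vf, Prod.fst_sum, Pi.single_apply]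
    · simp [Vf, Prod.snd_sum, Prod.fst_sum, Pi.single_apply]
    · simp only [Vf, Prod.snd_sum, Prod.snd_add, Prod.smul_snd, smul_eq_mul, Finset.mul_sum]
      refine Finset.sum_congr rfl fun j _ => ?_
      ring
  rw [h, map_sum]
  refine Finset.sum_congr rfl fun j _ => ?_
  rw [map_add, map_smul, map_smul, Xd_eq, Yd_eq]; rfl

/-- squared Euclidean length of the coefficients -/
def ab2 (n : ℕ) (a b : Fin n → ℝ) : ℝ := ∑ j, (a j ^ 2 + b j ^ 2)

lemma ab2_nonneg (n : ℕ) (a b : Fin n → ℝ) : 0 ≤ ab2 n a b :=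
  Finset.sum_nonneg fun _ _ => by positivity

lemma fderiv_Vf_sq_le (n : ℕ) (a b : Fin n → ℝ) (f : Hspace n → ℝ) (p : Hspace n) :
    (fderiv ℝ f p (Vf n a b p)) ^ 2 ≤ ab2 n a b * gradH2 n f p := by
  rw [fderiv_Vf]
  have h := Finset.sum_mul_sq_le_sq_mul_sq (Finset.univ : Finset (Fin n ⊕ Fin n))
    (Sum.elim a b) (Sum.elim (fun j => Xd n j f p) (fun j => Yd n j f p))
  simp only [Fintype.sum_sum_type, Sum.elim_inl, Sum.elim_inr] at h
  simpa only [ab2, gradH2, Finset.sum_add_distrib] using h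

lemma gradH2_nonneg (n : ℕ) (f : Hspace n → ℝ) (p : Hspace n) : 0 ≤ gradH2 n f p :=
  Finset.sum_nonneg fun _ _ => by positivity

lemma Vf_flow (n : ℕ) (a b : Fin n → ℝ) (p : Hspace n) (s : ℝ) :
    Vf n a b (p + s • Vf n a b p) = Vf n a b p := by
  simp only [Vf, Prod.snd_add, Prod.fst_add, Prod.smul_snd, Prod.smul_fst, Pi.add_apply,
    Pi.smul_apply, smul_eq_mul]
  congr 3
  refine Finset.sum_congr rfl fun j _ => ?_
  ring

lemma Vf_smul (n : ℕ) (a b : Fin n → ℝ) (p : Hspace n) (s : ℝ) :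
    s • Vf n a b p = Vf n (s • a) (s • b) p := by
  simp only [Vf, Prod.smul_mk, Pi.smul_apply, smul_eq_mul]
  congr 2
  rw [mul_left_comm, Finset.mul_sum]
  congr 1
  refine Finset.sum_congr rfl fun j _ => ?_
  ring

lemma continuous_Vf (n : ℕ) (a b : Fin n → ℝ) : Continuous (Vf n a b) := by
  unfold Vf; fun_prop

lemma contDiff_Vf (n : ℕ) (a b : Fin n → ℝ) {k : WithTop ℕ∞} : ContDiff ℝ k (Vf n a b) := by
  unfold Vf; fun_prop

/-- invariance of the measure under shears -/
lemma lintegral_shear (n : ℕ) (a b : Fin n → ℝ) (F : Hspace n → ENNReal) (hF : Measurable F) :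
    ∫⁻ p, F (p + Vf n a b p) = ∫⁻ p, F p := by
  have hm : Measurable (fun p => F (p + Vf n a b p)) :=
    hF.comp (continuous_id.add (continuous_Vf n a b)).measurable
  rw [MeasureTheory.Measure.volume_eq_prod, lintegral_prod _ hm.aemeasurable,
    lintegral_prod _ hF.aemeasurable]
  rw [← lintegral_add_right_eq_self (fun x => ∫⁻ q : (Fin n → ℝ) × ℝ, F (x, q)) a]
  refine lintegral_congr fun x => ?_
  have hm1 : Measurable (fun q : (Fin n → ℝ) × ℝ => F ((x, q) + Vf n a b (x, q))) :=
    hm.comp measurable_prodMk_left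
  have hm2 : Measurable (fun q : (Fin n → ℝ) × ℝ => F (x + a, q)) :=
    hF.comp measurable_prodMk_left
  rw [MeasureTheory.Measure.volume_eq_prod, lintegral_prod _ hm1.aemeasurable,
    lintegral_prod _ hm2.aemeasurable]
  rw [← lintegral_add_right_eq_self (fun y => ∫⁻ t : ℝ, F (x + a, y, t)) b]
  refine lintegral_congr fun y => ?_
  simp only [Vf, Prod.mk_add_mk]
  exact lintegral_add_right_eq_self (fun t => F (x + a, y + b, t)) _

lemma continuous_fderiv_Vf (n : ℕ) (a b : Fin n → ℝ) (f : Hspace n → ℝ) (hf : ContDiff ℝ 1 f) :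
    Continuous (fun p => fderiv ℝ f p (Vf n a b p)) :=
  (hf.continuous_fderiv one_ne_zero).clm_apply (continuous_Vf n a b)

lemma continuous_Xd (n : ℕ) (j : Fin n) (f : Hspace n → ℝ) (hf : ContDiff ℝ 1 f) :
    Continuous (Xd n j f) := by
  have : Xd n j f = fun p => fderiv ℝ f p (Vf n (Pi.single j 1) 0 p) := funext (Xd_eq n j f)
  rw [this]; exact continuous_fderiv_Vf _ _ _ _ hf

lemma continuous_Yd (n : ℕ) (j : Fin n) (f : Hspace n → ℝ) (hf : ContDiff ℝ 1 f) :
    Continuous (Yd n j f) := by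
  have : Yd n j f = fun p => fderiv ℝ f p (Vf n 0 (Pi.single j 1) p) := funext (Yd_eq n j f)
  rw [this]; exact continuous_fderiv_Vf _ _ _ _ hf

lemma continuous_gradH2 (n : ℕ) (f : Hspace n → ℝ) (hf : ContDiff ℝ 1 f) :
    Continuous (gradH2 n f) := by
  unfold gradH2
  have := fun j => continuous_Xd n j f hf
  have := fun j => continuous_Yd n j f hf
  fun_prop

lemma sq_integral_le (h : ℝ → ℝ) (hc : Continuous h) :
    ENNReal.ofReal ((∫ s in (0:ℝ)..1, h s) ^ 2) ≤
      ∫⁻ s in Set.Ioc (0:ℝ) 1, ENNReal.ofReal (h s ^ 2) := by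
  have hi : IntervalIntegrable (fun s => h s ^ 2) volume 0 1 := (hc.pow 2).intervalIntegrable _ _
  rw [← ofReal_integral_eq_lintegral_ofReal]
  · apply ENNReal.ofReal_le_ofReal
    rw [← intervalIntegral.integral_of_le zero_le_one]
    set I := ∫ s in (0:ℝ)..1, h s with hI
    have h1 : ∫ s in (0:ℝ)..1, (h s - I) ^ 2 = (∫ s in (0:ℝ)..1, h s ^ 2) - I ^ 2 := by
      have : ∀ s, (h s - I) ^ 2 = h s ^ 2 - (2 * I) * h s + I ^ 2 := fun s => by ring
      simp_rw [this]
      rw [intervalIntegral.integral_add, intervalIntegral.integral_sub,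
        intervalIntegral.integral_const_mul, ← hI]
      · simp; ring
      · exact hi
      · exact Continuous.intervalIntegrable (by fun_prop) _ _
      · exact Continuous.intervalIntegrable (by fun_prop) _ _
      · exact Continuous.intervalIntegrable (by fun_prop) _ _
    have h2 : 0 ≤ ∫ s in (0:ℝ)..1, (h s - I) ^ 2 :=
      intervalIntegral.integral_nonneg zero_le_one fun _ _ => sq_nonneg _
    linarith
  · exact hi.1
  · exact Filter.Eventually.of_forall fun _ => sq_nonneg _

lemma flow_sq (n : ℕ) (a b : Fin n → ℝ) (f : Hspace n → ℝ) (hf : ContDiff ℝ 1 f) :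
    ∫⁻ p, ENNReal.ofReal ((f (p + Vf n a b p) - f p) ^ 2) ≤
      ENNReal.ofReal (ab2 n a b) * ∫⁻ p, ENNReal.ofReal (gradH2 n f p) := by
  have hcont := continuous_fderiv_Vf n a b f hf
  have step : ∀ p, ENNReal.ofReal ((f (p + Vf n a b p) - f p) ^ 2) ≤
      ∫⁻ s in Set.Ioc (0:ℝ) 1, ENNReal.ofReal
        ((fun q => fderiv ℝ f q (Vf n a b q)) (p + s • Vf n a b p) ^ 2) := by
    intro p
    have hcl : Continuous (fun s : ℝ => p + s • Vf n a b p) := by fun_prop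
    have := sq_integral_le (fun s => (fun q => fderiv ℝ f q (Vf n a b q)) (p + s • Vf n a b p))
      (hcont.comp hcl)
    refine le_trans (le_of_eq ?_) this
    congr 2
    have hd : ∀ s ∈ Set.uIcc (0:ℝ) 1, HasDerivAt (fun s : ℝ => f (p + s • Vf n a b p))
        ((fun q => fderiv ℝ f q (Vf n a b q)) (p + s • Vf n a b p)) s := by
      intro s _
      have h1 : HasDerivAt (fun s : ℝ => p + s • Vf n a b p) (Vf n a b p) s := by
        simpa using ((hasDerivAt_id s).smul_const (Vf n a b p)).const_add p
      have h2 := ((hf.differentiable one_ne_zero) (p + s • Vf n a b p)).hasFDerivAt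
      have h3 := h2.comp_hasDerivAt s h1
      show HasDerivAt _ (fderiv ℝ f (p + s • Vf n a b p) (Vf n a b (p + s • Vf n a b p))) s
      rw [Vf_flow]
      exact h3
    rw [intervalIntegral.integral_eq_sub_of_hasDerivAt hd
      ((hcont.comp hcl).intervalIntegrable _ _)]
    simp
  have hjoint : Measurable (fun z : Hspace n × ℝ => ENNReal.ofReal
        ((fun q => fderiv ℝ f q (Vf n a b q)) (z.1 + z.2 • Vf n a b z.1) ^ 2)) := by
    apply ENNReal.measurable_ofReal.comp
    apply Continuous.measurable
    have h1 : Continuous (fun z : Hspace n × ℝ => z.1 + z.2 • Vf n a b z.1) := by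
      have := continuous_Vf n a b
      fun_prop
    exact (hcont.comp h1).pow 2
  calc _ ≤ ∫⁻ p, ∫⁻ s in Set.Ioc (0:ℝ) 1, ENNReal.ofReal
        ((fun q => fderiv ℝ f q (Vf n a b q)) (p + s • Vf n a b p) ^ 2) := lintegral_mono step
    _ = ∫⁻ s in Set.Ioc (0:ℝ) 1, ∫⁻ p, ENNReal.ofReal
        ((fun q => fderiv ℝ f q (Vf n a b q)) (p + s • Vf n a b p) ^ 2) :=
        lintegral_lintegral_swap hjoint.aemeasurable
    _ = ∫⁻ s in Set.Ioc (0:ℝ) 1, ∫⁻ p, ENNReal.ofReal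
        ((fun q => fderiv ℝ f q (Vf n a b q)) p ^ 2) := by
        refine lintegral_congr fun s => ?_
        simp_rw [Vf_smul]
        refine lintegral_shear n (s • a) (s • b)
          (fun p => ENNReal.ofReal ((fun q => fderiv ℝ f q (Vf n a b q)) p ^ 2)) ?_
        exact ENNReal.measurable_ofReal.comp (hcont.pow 2).measurable
    _ = ∫⁻ p, ENNReal.ofReal ((fun q => fderiv ℝ f q (Vf n a b q)) p ^ 2) := by
        simp
    _ ≤ ∫⁻ p, ENNReal.ofReal (ab2 n a b) * ENNReal.ofReal (gradH2 n f p) := by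
        refine lintegral_mono fun p => ?_
        rw [← ENNReal.ofReal_mul (ab2_nonneg n a b)]
        exact ENNReal.ofReal_le_ofReal (fderiv_Vf_sq_le n a b f p)
    _ = _ := by
        rw [lintegral_const_mul]
        exact ENNReal.measurable_ofReal.comp (continuous_gradH2 n f hf).measurable

/-- A measure-preserving map moving functions by a controlled `L²` amount. -/
def GoodMap (n : ℕ) (T : Hspace n → Hspace n) (K : ℝ) : Prop :=
  Continuous T ∧ (∀ F : Hspace n → ENNReal, Measurable F → ∫⁻ p, F (T p) = ∫⁻ p, F p) ∧
  ∀ f : Hspace n → ℝ, ContDiff ℝ 1 f → ∫⁻ p, ENNReal.ofReal ((f (T p) - f p) ^ 2) ≤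
      ENNReal.ofReal K * ∫⁻ p, ENNReal.ofReal (gradH2 n f p)

lemma goodMap_id (n : ℕ) : GoodMap n id 0 :=
  ⟨continuous_id, fun _ _ => rfl, fun f _ => by simp⟩

lemma goodMap_step (n : ℕ) {T : Hspace n → Hspace n} {K : ℝ} (hK : 0 ≤ K) (hT : GoodMap n T K)
    (a b : Fin n → ℝ) :
    GoodMap n (fun p => T p + Vf n a b (T p)) (2 * (K + ab2 n a b)) := by
  obtain ⟨h1, h2, h3⟩ := hT
  have hS : Continuous (fun p => p + Vf n a b p) := continuous_id.add (continuous_Vf n a b)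
  refine ⟨hS.comp h1, fun F hF => ?_, fun f hf => ?_⟩
  · rw [h2 (fun p => F (p + Vf n a b p)) (hF.comp hS.measurable), lintegral_shear n a b F hF]
  · have hA : Measurable (fun p => ENNReal.ofReal ((f (p + Vf n a b p) - f p) ^ 2)) := by
      apply ENNReal.measurable_ofReal.comp
      exact (((hf.continuous.comp hS).sub hf.continuous).pow 2).measurable
    have hB : Measurable (fun p => ENNReal.ofReal ((f (T p) - f p) ^ 2)) := by
      apply ENNReal.measurable_ofReal.comp
      exact (((hf.continuous.comp h1).sub hf.continuous).pow 2).measurable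
    calc _ ≤ ∫⁻ p, 2 * (ENNReal.ofReal ((f (T p) - f p) ^ 2) +
            ENNReal.ofReal ((f (T p + Vf n a b (T p)) - f (T p)) ^ 2)) := by
          refine lintegral_mono fun p => ?_
          rw [← ENNReal.ofReal_add (sq_nonneg _) (sq_nonneg _),
            show (2 : ENNReal) = ENNReal.ofReal 2 by simp,
            ← ENNReal.ofReal_mul (by norm_num)]
          apply ENNReal.ofReal_le_ofReal
          nlinarith [sq_nonneg ((f (T p + Vf n a b (T p)) - f (T p)) - (f (T p) - f p))]
      _ = 2 * ((∫⁻ p, ENNReal.ofReal ((f (T p) - f p) ^ 2)) +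
            ∫⁻ p, ENNReal.ofReal ((f (p + Vf n a b p) - f p) ^ 2)) := by
          rw [lintegral_const_mul' _ _ (by simp), lintegral_add_left hB,
            h2 (fun p => ENNReal.ofReal ((f (p + Vf n a b p) - f p) ^ 2)) hA]
      _ ≤ 2 * ((ENNReal.ofReal K * ∫⁻ p, ENNReal.ofReal (gradH2 n f p)) +
            ENNReal.ofReal (ab2 n a b) * ∫⁻ p, ENNReal.ofReal (gradH2 n f p)) := by
          gcongr
          · exact h3 f hf
          · exact flow_sq n a b f hf
      _ = _ := by
          rw [← add_mul, ← ENNReal.ofReal_add hK (ab2_nonneg n a b), ← mul_assoc,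
            ENNReal.ofReal_mul (by norm_num)]
          simp

/-- Translation by a group element, parametrised linearly. -/
def Th (n : ℕ) (r : ℝ) (q p : Hspace n) : Hspace n :=
  (p.1 + q.1, p.2.1 + q.2.1,
    p.2.2 + 2 * ∑ j, (p.2.1 j * q.1 j - p.1 j * q.2.1 j) + (-(4 * r)) * q.2.2)

/-- The parameter cube. -/
def cube (n : ℕ) (r : ℝ) : Set (Hspace n) :=
  Set.Icc 0 (fun _ => r) ×ˢ (Set.Icc 0 (fun _ => r) ×ˢ Set.Icc 0 r)

lemma ab2_single_left (n : ℕ) (i : Fin n) (r : ℝ) : ab2 n (Pi.single i r) 0 = r ^ 2 := by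
  simp [ab2, Pi.single_apply]

lemma ab2_single_right (n : ℕ) (i : Fin n) (r : ℝ) : ab2 n 0 (Pi.single i r) = r ^ 2 := by
  simp [ab2, Pi.single_apply]

lemma GoodMap.mono {n : ℕ} {T : Hspace n → Hspace n} {K K' : ℝ} (h : GoodMap n T K)
    (hKK : K ≤ K') : GoodMap n T K' := by
  refine ⟨h.1, h.2.1, fun f hf => (h.2.2 f hf).trans ?_⟩
  gcongr

lemma goodMap_Th (n : ℕ) (i : Fin n) (r : ℝ) (hr : 0 ≤ r) (q : Hspace n) (hq : q ∈ cube n r) :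
    GoodMap n (Th n r q) ((60 + 4 * n) * r ^ 2) := by
  obtain ⟨a, b, c⟩ := q
  obtain ⟨⟨ha0, ha1⟩, ⟨hb0, hb1⟩, hc0, hc1⟩ := hq
  simp only at ha0 ha1 hb0 hb1 hc0 hc1
  have g1 := goodMap_step n le_rfl (goodMap_id n) (Pi.single i r) 0
  rw [ab2_single_left] at g1
  have g2 := goodMap_step n (by positivity) g1 0 (Pi.single i c)
  rw [ab2_single_right] at g2
  have g3 := goodMap_step n (by positivity) g2 (Pi.single i (-r)) 0
  rw [ab2_single_left] at g3
  have g4 := goodMap_step n (by positivity) g3 0 (Pi.single i (-c))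
  rw [ab2_single_right] at g4
  have g5 := goodMap_step n (by positivity) g4 a b
  have habr : ab2 n a b ≤ 2 * n * r ^ 2 := by
    have : ∀ j ∈ Finset.univ, a j ^ 2 + b j ^ 2 ≤ 2 * r ^ 2 := by
      intro j _
      have h1 := ha0 j; have h2 := ha1 j; have h3 := hb0 j; have h4 := hb1 j
      simp only [Pi.zero_apply] at h1 h2 h3 h4
      nlinarith
    have := Finset.sum_le_card_nsmul _ _ _ this
    simp only [Finset.card_univ, Fintype.card_fin, nsmul_eq_mul] at this
    unfold ab2
    linarith
  have hcr : c ^ 2 ≤ r ^ 2 := by gcongr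
  have hK : 2 * (2 * (2 * (2 * (2 * (0 + r ^ 2) + c ^ 2) + (-r) ^ 2) + (-c) ^ 2) + ab2 n a b) ≤
      (60 + 4 * n) * r ^ 2 := by nlinarith
  refine GoodMap.mono ?_ hK
  · convert g5 using 1
    funext p
    ext k
    · simp only [Th, Vf, id, Prod.fst_add, Pi.add_apply]
      by_cases h : k = i <;> simp [Pi.single_apply, h]
    · simp only [Th, Vf, id, Prod.fst_add, Prod.snd_add, Pi.add_apply]
      by_cases h : k = i <;> simp [Pi.single_apply, h]
    · simp only [Th, Vf, id, Prod.fst_add, Prod.snd_add, Pi.add_apply, Pi.zero_apply, mul_zero,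
        sub_zero, zero_sub, Pi.single_apply]
      have e1 : ∀ j : Fin n, (p.2.1 j + 0 + (if j = i then c else 0) + 0 + (if j = i then -c else 0))
          = p.2.1 j := by intro j; by_cases h : j = i <;> simp [h]
      have e2 : ∀ j : Fin n, (p.1 j + (if j = i then r else 0) + 0 + (if j = i then -r else 0) + 0)
          = p.1 j := by intro j; by_cases h : j = i <;> simp [h]
      simp_rw [e1, e2]
      simp [Finset.sum_neg_distrib]
      ring

lemma continuous_Th (n : ℕ) (r : ℝ) :
    Continuous (fun z : Hspace n × Hspace n => Th n r z.1 z.2) := by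
  unfold Th; fun_prop

lemma volume_cube (n : ℕ) (r : ℝ) (hr : 0 ≤ r) :
    volume (cube n r) = ENNReal.ofReal (r ^ (2 * n + 1)) := by
  unfold cube
  rw [Measure.volume_eq_prod, Measure.prod_prod, Measure.volume_eq_prod, Measure.prod_prod,
    Real.volume_Icc_pi, Real.volume_Icc]
  simp only [Pi.zero_apply, sub_zero, Finset.prod_const, Finset.card_univ, Fintype.card_fin]
  rw [← ENNReal.ofReal_pow hr, ← ENNReal.ofReal_mul (by positivity),
    ← ENNReal.ofReal_mul (by positivity)]
  congr 1; ring

lemma lintegral_affine (F : ℝ → ENNReal) (hF : Measurable F) (A c : ℝ) (hc : c ≠ 0) :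
    ENNReal.ofReal |c| * ∫⁻ t, F (A + c * t) = ∫⁻ t, F t := by
  have h2 : ∫⁻ t, F t = ∫⁻ t, F (A + t) := (lintegral_add_left_eq_self F A).symm
  rw [h2]
  have hm : Measurable (fun t => F (A + t)) := by fun_prop
  conv_rhs => rw [← Real.smul_map_volume_mul_left hc]
  rw [lintegral_smul_measure, lintegral_map hm (by fun_prop)]
  rfl

lemma lintegral_Th (n : ℕ) (r : ℝ) (hr : 0 < r) (p : Hspace n) (F : Hspace n → ENNReal)
    (hF : Measurable F) :
    ENNReal.ofReal (4 * r) * ∫⁻ q, F (Th n r q p) = ∫⁻ q, F q := by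
  have hT : Continuous (fun q => Th n r q p) :=
    (continuous_Th n r).comp (Continuous.prodMk continuous_id continuous_const)
  have hm : Measurable (fun q => F (Th n r q p)) := hF.comp hT.measurable
  rw [MeasureTheory.Measure.volume_eq_prod, lintegral_prod _ hm.aemeasurable,
    lintegral_prod _ hF.aemeasurable]
  rw [← lintegral_add_left_eq_self (fun x => ∫⁻ q : (Fin n → ℝ) × ℝ, F (x, q)) p.1]
  rw [← lintegral_const_mul' _ _ ENNReal.ofReal_ne_top]
  refine lintegral_congr fun x => ?_
  have hm1 : Measurable (fun q : (Fin n → ℝ) × ℝ => F (Th n r (x, q) p)) :=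
    hm.comp measurable_prodMk_left
  have hm2 : Measurable (fun q : (Fin n → ℝ) × ℝ => F (p.1 + x, q)) :=
    hF.comp measurable_prodMk_left
  rw [MeasureTheory.Measure.volume_eq_prod, lintegral_prod _ hm1.aemeasurable,
    lintegral_prod _ hm2.aemeasurable]
  rw [← lintegral_add_left_eq_self (fun y => ∫⁻ t : ℝ, F (p.1 + x, y, t)) p.2.1]
  rw [← lintegral_const_mul' _ _ ENNReal.ofReal_ne_top]
  refine lintegral_congr fun y => ?_
  simp only [Th]
  have := lintegral_affine (fun t => F (p.1 + x, p.2.1 + y, t)) (by fun_prop)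
    (p.2.2 + 2 * ∑ j, (p.2.1 j * x j - p.1 j * y j)) (-(4 * r)) (by linarith)
  rw [abs_neg, abs_of_pos (by linarith)] at this
  exact this

lemma level_est (n : ℕ) (i : Fin n) (f : Hspace n → ℝ) (hf : ContDiff ℝ 1 f) (r m : ℝ) (hr : 0 < r)
    (hm : volume {p | f p ≠ 0} ≤ ENNReal.ofReal m) (hrm : m ≤ 2 * r ^ (2 * n + 2)) :
    volume {p | f p = 1} ≤
      ENNReal.ofReal (2 * (60 + 4 * n) * r ^ 2) * ∫⁻ p, ENNReal.ofReal (gradH2 n f p) := by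
  set G := ∫⁻ p, ENNReal.ofReal (gradH2 n f p) with hG
  set E := {p | f p = 1} with hE
  have hEm : MeasurableSet E := measurableSet_eq_fun hf.continuous.measurable measurable_const
  set D := ENNReal.ofReal (r ^ (2 * n + 1)) with hD
  have hD0 : D ≠ 0 := by simp [hD]; positivity
  have hDt : D ≠ ⊤ := by simp [hD]
  have hcm : MeasurableSet (cube n r) :=
    measurableSet_Icc.prod (measurableSet_Icc.prod measurableSet_Icc)
  have hjoint : Measurable (fun z : Hspace n × Hspace n =>
      ENNReal.ofReal ((f (Th n r z.1 z.2) - f z.2) ^ 2)) := by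
    apply ENNReal.measurable_ofReal.comp
    exact (((hf.continuous.comp (continuous_Th n r)).sub
      (hf.continuous.comp continuous_snd)).pow 2).measurable
  have upper : ∫⁻ q in cube n r, ∫⁻ p, ENNReal.ofReal ((f (Th n r q p) - f p) ^ 2) ≤
      ENNReal.ofReal ((60 + 4 * n) * r ^ 2) * G * D := by
    rw [hD, ← volume_cube n r hr.le, ← setLIntegral_const]
    refine setLIntegral_mono' hcm fun q hq => ?_
    exact (goodMap_Th n i r hr.le q hq).2.2 f hf
  rw [lintegral_lintegral_swap hjoint.aemeasurable] at upper
  have lower : ∀ p ∈ E, D / 2 ≤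
      ∫⁻ q in cube n r, ENNReal.ofReal ((f (Th n r q p) - f p) ^ 2) := by
    intro p hp
    have hp1 : f p = 1 := hp
    set Z := {q | f (Th n r q p) ≠ 0} with hZ
    have hT : Continuous (fun q => Th n r q p) :=
      (continuous_Th n r).comp (Continuous.prodMk continuous_id continuous_const)
    have hZo : IsOpen Z := isOpen_ne_fun (hf.continuous.comp hT) continuous_const
    have hSo : IsOpen {p | f p ≠ 0} := isOpen_ne_fun hf.continuous continuous_const
    have hZv : volume Z ≤ D / 2 := by
      have h := lintegral_Th n r hr p (Set.indicator {p | f p ≠ 0} 1)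
        (measurable_one.indicator hSo.measurableSet)
      rw [lintegral_indicator_one hSo.measurableSet] at h
      have h' : ∫⁻ q, Set.indicator {p | f p ≠ 0} (1 : Hspace n → ENNReal) (Th n r q p)
          = volume Z := by
        rw [← lintegral_indicator_one hZo.measurableSet]; rfl
      rw [h'] at h
      have h4 : ENNReal.ofReal (4 * r) * volume Z ≤ ENNReal.ofReal (4 * r) * (D / 2) := by
        rw [h]
        refine hm.trans ?_
        rw [hD, show (2 : ENNReal) = ENNReal.ofReal 2 by simp,
          ← ENNReal.ofReal_div_of_pos (by norm_num),
          ← ENNReal.ofReal_mul (by positivity)]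
        apply ENNReal.ofReal_le_ofReal
        calc m ≤ _ := hrm
          _ = _ := by ring
      exact (ENNReal.mul_le_mul_iff_right (by simp; positivity) ENNReal.ofReal_ne_top).1 h4
    calc D / 2 = D - D / 2 := (ENNReal.sub_half hDt).symm
      _ ≤ volume (cube n r) - volume Z := by
          rw [volume_cube n r hr.le, ← hD]
          exact tsub_le_tsub_left hZv _
      _ ≤ volume (cube n r \ Z) := le_measure_sdiff
      _ = ∫⁻ q in cube n r \ Z, 1 := by simp
      _ ≤ ∫⁻ q in cube n r \ Z, ENNReal.ofReal ((f (Th n r q p) - f p) ^ 2) := by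
          refine setLIntegral_mono' (hcm.diff hZo.measurableSet) fun q hq => ?_
          have : f (Th n r q p) = 0 := by
            by_contra h
            exact hq.2 h
          rw [this, hp1]; simp
      _ ≤ _ := lintegral_mono_set Set.sdiff_subset
  have h3 : D / 2 * volume E ≤ ENNReal.ofReal ((60 + 4 * n) * r ^ 2) * G * D := by
    refine le_trans ?_ upper
    rw [← setLIntegral_const]
    refine le_trans (setLIntegral_mono' hEm lower) (setLIntegral_le_lintegral _ _)
  have h5 : D * volume E ≤ D * (ENNReal.ofReal (2 * (60 + 4 * n) * r ^ 2) * G) := by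
    calc D * volume E = 2 * (D / 2 * volume E) := by
          rw [← mul_assoc, ENNReal.mul_div_cancel (by simp) (by simp)]
      _ ≤ 2 * (ENNReal.ofReal ((60 + 4 * n) * r ^ 2) * G * D) := by gcongr
      _ = _ := by
          rw [mul_assoc (2 : ℝ), ENNReal.ofReal_mul (by norm_num : (0:ℝ) ≤ 2),
            ENNReal.ofReal_ofNat]
          ring
  exact (ENNReal.mul_le_mul_iff_right hD0 hDt).1 h5

lemma smoothTransition_deriv_zero {x : ℝ} (hx : x ≤ 0 ∨ 1 ≤ x) :
    deriv Real.smoothTransition x = 0 := by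
  rcases hx with h | h
  · apply IsLocalMin.deriv_eq_zero
    refine Filter.Eventually.of_forall fun y => ?_
    rw [Real.smoothTransition.zero_of_nonpos h]
    exact Real.smoothTransition.nonneg y
  · apply IsLocalMax.deriv_eq_zero
    refine Filter.Eventually.of_forall fun y => ?_
    rw [Real.smoothTransition.one_of_one_le h]
    exact Real.smoothTransition.le_one y

lemma smoothTransition_deriv_bound : ∃ K : ℝ, 0 < K ∧
    ∀ x, (deriv Real.smoothTransition x) ^ 2 ≤ K := by
  have hc : Continuous (deriv Real.smoothTransition) :=
    (Real.smoothTransition.contDiff (n := 1)).continuous_deriv le_rfl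
  obtain ⟨K, hK⟩ := (isCompact_Icc (a := (0:ℝ)) (b := 1)).exists_bound_of_continuousOn
    (hc.pow 2).continuousOn
  refine ⟨max K 1, by positivity, fun x => ?_⟩
  by_cases hx : x ∈ Set.Icc (0:ℝ) 1
  · have := hK x hx
    rw [Real.norm_eq_abs] at this
    exact (le_abs_self _).trans (this.trans (le_max_left _ _))
  · rw [smoothTransition_deriv_zero]
    · simp
    · rw [Set.mem_Icc, not_and_or] at hx
      rcases hx with h | h
      · left; linarith
      · right; linarith

lemma fderiv_comp_apply (n : ℕ) (g : Hspace n → ℝ) (Φ : ℝ → ℝ) (p v : Hspace n) (d : ℝ)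
    (hg : DifferentiableAt ℝ g p) (hΦ : HasDerivAt Φ d (g p)) :
    fderiv ℝ (fun p => Φ (g p)) p v = d * fderiv ℝ g p v := by
  have h := hΦ.comp_hasFDerivAt p hg.hasFDerivAt
  have h2 : fderiv ℝ (fun p => Φ (g p)) p = d • fderiv ℝ g p := h.fderiv
  rw [h2]; rfl

lemma gradH2_comp (n : ℕ) (g : Hspace n → ℝ) (Φ : ℝ → ℝ) (p : Hspace n) (d : ℝ)
    (hg : DifferentiableAt ℝ g p) (hΦ : HasDerivAt Φ d (g p)) :
    gradH2 n (fun p => Φ (g p)) p = d ^ 2 * gradH2 n g p := by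
  simp only [gradH2, Xd_eq, Yd_eq, fderiv_comp_apply n g Φ p _ d hg hΦ, Finset.mul_sum]
  refine Finset.sum_congr rfl fun j _ => ?_
  ring

lemma level_step (n : ℕ) (hn : 1 ≤ n) : ∃ C : ℝ, 0 < C ∧ ∀ g : Hspace n → ℝ, ContDiff ℝ 1 g →
    ∀ J : ℝ, 0 < J → ∀ l : ℝ, 0 < l →
    volume {p | l < g p} ≤ ENNReal.ofReal (J / l ^ ((2 * n + 2 : ℝ) / n)) →
    ENNReal.ofReal (l ^ ((2 * n + 2 : ℝ) / n)) * volume {p | 2 * l ≤ g p} ≤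
      ENNReal.ofReal (C * J ^ (1 / (n + 1 : ℝ))) *
        ∫⁻ p in {p | l ≤ g p ∧ g p < 2 * l}, ENNReal.ofReal (gradH2 n g p) := by
  obtain ⟨K, hK0, hK⟩ := smoothTransition_deriv_bound
  have hn0 : (0:ℝ) < n := by exact_mod_cast hn
  refine ⟨2 * (60 + 4 * n) * K, by positivity, fun g hg J hJ l hl hv => ?_⟩
  set q : ℝ := (2 * n + 2 : ℝ) / n with hq
  set Φ : ℝ → ℝ := fun x => Real.smoothTransition (x / l - 1) with hΦ
  have hΦc : ContDiff ℝ 1 Φ := by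
    apply (Real.smoothTransition.contDiff (n := 1)).comp
    fun_prop
  have hΦd : ∀ x, HasDerivAt Φ (deriv Real.smoothTransition (x / l - 1) * (1 / l)) x := by
    intro x
    have h1 : HasDerivAt (fun x : ℝ => x / l - 1) (1 / l) x :=
      ((hasDerivAt_id x).div_const l).sub_const 1
    have h2 : HasDerivAt Real.smoothTransition (deriv Real.smoothTransition (x / l - 1))
        (x / l - 1) :=
      ((Real.smoothTransition.contDiff (n := 1)).differentiable one_ne_zero _).hasDerivAt
    exact h2.comp x h1
  set f : Hspace n → ℝ := fun p => Φ (g p) with hf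
  have hfc : ContDiff ℝ 1 f := hΦc.comp hg
  have hf0 : {p | f p ≠ 0} = {p | l < g p} := by
    ext p
    simp only [hf, hΦ, Set.mem_setOf_eq, ne_eq, Real.smoothTransition.zero_iff_nonpos, not_le,
      sub_pos, one_lt_div hl]
  have hf1 : {p | f p = 1} = {p | 2 * l ≤ g p} := by
    ext p
    simp only [hf, hΦ, Set.mem_setOf_eq, Real.smoothTransition.eq_one_iff_one_le]
    rw [le_sub_iff_add_le, le_div_iff₀ hl]; norm_num
  set m := J / l ^ q with hm
  have hm0 : 0 < m := by positivity
  set r : ℝ := m ^ (1 / (2 * n + 2 : ℝ)) with hr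
  have hr0 : 0 < r := by positivity
  have hrp : r ^ (2 * n + 2) = m := by
    rw [hr, ← Real.rpow_natCast, ← Real.rpow_mul hm0.le]
    push_cast
    rw [one_div_mul_cancel (by positivity), Real.rpow_one]
  have hr2 : r ^ 2 = J ^ (1 / (n + 1 : ℝ)) * l ^ (2 : ℝ) / l ^ q := by
    rw [hr, ← Real.rpow_natCast, ← Real.rpow_mul hm0.le, hm,
      Real.div_rpow hJ.le (by positivity), ← Real.rpow_mul hl.le, mul_div_assoc, ← Real.rpow_sub hl,
      div_eq_mul_inv, ← Real.rpow_neg hl.le]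
    congr 2
    · push_cast; field_simp
    · rw [hq]; push_cast; field_simp; ring
  have key := level_est n ⟨0, hn⟩ f hfc r m hr0 (by rw [hf0]; exact hv) (by rw [hrp]; linarith)
  rw [hf1] at key
  have hA : MeasurableSet {p | l ≤ g p ∧ g p < 2 * l} :=
    (measurableSet_le measurable_const hg.continuous.measurable).inter
      (measurableSet_lt hg.continuous.measurable measurable_const)
  have hgrad : ∫⁻ p, ENNReal.ofReal (gradH2 n f p) ≤ ENNReal.ofReal (K / l ^ (2:ℝ)) *
      ∫⁻ p in {p | l ≤ g p ∧ g p < 2 * l}, ENNReal.ofReal (gradH2 n g p) := by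
    rw [← lintegral_indicator hA, ← lintegral_const_mul' _ _ ENNReal.ofReal_ne_top]
    refine lintegral_mono fun p => ?_
    have hgr := gradH2_comp n g Φ p _ (hg.differentiable one_ne_zero p) (hΦd (g p))
    by_cases hp : p ∈ {p | l ≤ g p ∧ g p < 2 * l}
    · rw [Set.indicator_of_mem hp, ← ENNReal.ofReal_mul (by positivity), hf, hgr]
      apply ENNReal.ofReal_le_ofReal
      apply mul_le_mul_of_nonneg_right _ (gradH2_nonneg n g p)
      rw [mul_pow, div_pow, one_pow, Real.rpow_two, div_eq_mul_one_div K]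
      gcongr
      exact hK _
    · rw [hf, hgr, smoothTransition_deriv_zero]
      · simp
      · rw [Set.mem_setOf_eq, not_and_or, not_le, not_lt] at hp
        rcases hp with h | h
        · left
          rw [sub_nonpos, div_le_one hl]; exact h.le
        · right
          rw [le_sub_iff_add_le, le_div_iff₀ hl]; linarith
  calc _ ≤ ENNReal.ofReal (l ^ q) * (ENNReal.ofReal (2 * (60 + 4 * n) * r ^ 2) *
        (ENNReal.ofReal (K / l ^ (2:ℝ)) *
      ∫⁻ p in {p | l ≤ g p ∧ g p < 2 * l}, ENNReal.ofReal (gradH2 n g p))) := by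
        gcongr
        exact key.trans (by gcongr)
    _ = _ := by
        rw [← mul_assoc, ← mul_assoc, ← ENNReal.ofReal_mul (by positivity),
          ← ENNReal.ofReal_mul (by positivity), hr2]
        congr 2
        field_simp

theorem sobolev (n : ℕ) (hn : 1 ≤ n) : ∃ C : ℝ, 0 < C ∧ ∀ g : Hspace n → ℝ, ContDiff ℝ 1 g →
    HasCompactSupport g → (∀ p, 0 ≤ g p) →
    (∫ p, g p ^ ((2 * n + 2 : ℝ) / n)) ^ ((n : ℝ) / (n + 1)) ≤ C * ∫ p, gradH2 n g p := by
  obtain ⟨C, hC0, hC⟩ := level_step n hn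
  have hn0 : (0:ℝ) < n := by exact_mod_cast hn
  set q : ℝ := (2 * n + 2 : ℝ) / n with hq
  have hq0 : 0 < q := by positivity
  refine ⟨4 ^ q * C, by positivity, fun g hg hgs hg0 => ?_⟩
  have hgrad_c : Continuous (gradH2 n g) := continuous_gradH2 n g hg
  have hgrad_s : HasCompactSupport (gradH2 n g) := by
    refine HasCompactSupport.mono' (hgs.fderiv ℝ) ?_
    intro p hp
    by_contra h
    apply hp
    have : fderiv ℝ g p = 0 := image_eq_zero_of_notMem_tsupport h
    simp [gradH2, Xd, Yd, this]
  have hgrad_i : Integrable (gradH2 n g) := hgrad_c.integrable_of_hasCompactSupport hgrad_s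
  have hgq_c : Continuous (fun p => g p ^ q) :=
    hg.continuous.rpow_const fun p => Or.inr hq0.le
  have hgq_i : Integrable (fun p => g p ^ q) := by
    refine hgq_c.integrable_of_hasCompactSupport ?_
    exact hgs.comp_left (g := fun x : ℝ => x ^ q) (Real.zero_rpow hq0.ne')
  set J := ∫ p, g p ^ q with hJ
  set B := ∫ p, gradH2 n g p with hB
  have hB0 : 0 ≤ B := integral_nonneg fun p => gradH2_nonneg n g p
  have hJ0 : 0 ≤ J := integral_nonneg fun p => Real.rpow_nonneg (hg0 p) _
  rcases hJ0.eq_or_lt with hJz | hJpos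
  · rw [← hJz, Real.zero_rpow (by positivity)]; positivity
  have hJl : ENNReal.ofReal J = ∫⁻ p, ENNReal.ofReal (g p ^ q) :=
    ofReal_integral_eq_lintegral_ofReal hgq_i
      (Filter.Eventually.of_forall fun p => Real.rpow_nonneg (hg0 p) _)
  have hBl : ENNReal.ofReal B = ∫⁻ p, ENNReal.ofReal (gradH2 n g p) :=
    ofReal_integral_eq_lintegral_ofReal hgrad_i
      (Filter.Eventually.of_forall fun p => gradH2_nonneg n g p)
  -- Markov
  have markov : ∀ l : ℝ, 0 < l → volume {p | l < g p} ≤ ENNReal.ofReal (J / l ^ q) := by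
    intro l hl
    have hlq : 0 < l ^ q := by positivity
    rw [ENNReal.ofReal_div_of_pos hlq, ENNReal.le_div_iff_mul_le (by simp [hlq]) (by simp), mul_comm,
      hJl]
    refine le_trans ?_ (mul_meas_ge_le_lintegral₀
      (ENNReal.measurable_ofReal.comp hgq_c.measurable).aemeasurable (ENNReal.ofReal (l ^ q)))
    refine mul_le_mul_right (measure_mono ?_) _
    intro p hp
    have hp' : l < g p := hp
    exact ENNReal.ofReal_le_ofReal (Real.rpow_le_rpow hl.le hp'.le hq0.le)
  set A : ℤ → Set (Hspace n) := fun k => {p | (2:ℝ) ^ k ≤ g p ∧ g p < 2 * (2:ℝ) ^ k} with hA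
  have hAm : ∀ k, MeasurableSet (A k) := fun k =>
    (measurableSet_le measurable_const hg.continuous.measurable).inter
      (measurableSet_lt hg.continuous.measurable measurable_const)
  have hAlt : ∀ k l, k < l → Disjoint (A k) (A l) := by
    intro k l hkl
    rw [Set.disjoint_left]
    rintro p ⟨_, h1⟩ ⟨h2, _⟩
    have : (2:ℝ) * 2 ^ k ≤ 2 ^ l := by
      rw [mul_comm, ← zpow_add_one₀ (by norm_num)]
      exact zpow_le_zpow_right₀ (by norm_num) hkl
    linarith
  have hAd : Pairwise (Function.onFun Disjoint A) := by
    intro k l hkl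
    rcases lt_or_gt_of_ne hkl with h | h
    · exact hAlt k l h
    · exact (hAlt l k h).symm
  have sumB : ∑' k, ∫⁻ p in A k, ENNReal.ofReal (gradH2 n g p) ≤ ENNReal.ofReal B := by
    rw [← lintegral_iUnion hAm hAd, hBl]
    exact setLIntegral_le_lintegral _ _
  have sumJ : ENNReal.ofReal J ≤ ∑' k : ℤ, ENNReal.ofReal (4 ^ q) *
      (ENNReal.ofReal (((2:ℝ) ^ k) ^ q) * volume {p | 2 * (2:ℝ) ^ k ≤ g p}) := by
    have hsub : ∫⁻ p, ENNReal.ofReal (g p ^ q) ≤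
        ∫⁻ p in ⋃ k : ℤ, A (k + 1), ENNReal.ofReal (g p ^ q) := by
      rw [← lintegral_indicator (MeasurableSet.iUnion fun k => hAm (k + 1))]
      refine lintegral_mono fun p => ?_
      rcases (hg0 p).eq_or_lt with h | h
      · simp [← h, Real.zero_rpow hq0.ne']
      · have hmem : p ∈ ⋃ k : ℤ, A (k + 1) := by
          obtain ⟨k, hk1, hk2⟩ := exists_mem_Ico_zpow h (by norm_num : (1:ℝ) < 2)
          rw [Set.mem_iUnion]
          refine ⟨k - 1, ?_⟩
          simp only [hA, Set.mem_setOf_eq, sub_add_cancel]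
          refine ⟨hk1, ?_⟩
          rw [mul_comm, ← zpow_add_one₀ (by norm_num)]; exact hk2
        rw [Set.indicator_of_mem hmem]
    rw [hJl]
    refine hsub.trans ((lintegral_iUnion_le _ _).trans ?_)
    refine ENNReal.tsum_le_tsum fun k => ?_
    have hk0 : (0:ℝ) < 2 ^ k := by positivity
    have hk1 : (2:ℝ) ^ (k + 1) = 2 * 2 ^ k := by rw [zpow_add_one₀ (by norm_num), mul_comm]
    calc ∫⁻ p in A (k + 1), ENNReal.ofReal (g p ^ q)
        ≤ ∫⁻ p in A (k + 1), ENNReal.ofReal ((4 * 2 ^ k) ^ q) := by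
          refine setLIntegral_mono' (hAm _) fun p hp => ?_
          have h2 : g p < 2 * (2:ℝ) ^ (k + 1) := hp.2
          apply ENNReal.ofReal_le_ofReal
          apply Real.rpow_le_rpow (hg0 p) _ hq0.le
          rw [hk1] at h2; linarith
      _ = ENNReal.ofReal ((4 * 2 ^ k) ^ q) * volume (A (k + 1)) := setLIntegral_const _ _
      _ ≤ ENNReal.ofReal ((4 * 2 ^ k) ^ q) * volume {p | 2 * (2:ℝ) ^ k ≤ g p} := by
          gcongr
          intro p hp
          have h2 : (2:ℝ) ^ (k + 1) ≤ g p := hp.1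
          rw [hk1] at h2; exact h2
      _ = _ := by
          rw [Real.mul_rpow (by norm_num) hk0.le, ENNReal.ofReal_mul (by positivity), mul_assoc]
  have fin : ENNReal.ofReal J ≤
      ENNReal.ofReal (4 ^ q * (C * J ^ (1 / (n + 1 : ℝ))) * B) := by
    refine sumJ.trans ?_
    rw [ENNReal.tsum_mul_left, ENNReal.ofReal_mul (by positivity),
      ENNReal.ofReal_mul (by positivity), mul_assoc]
    gcongr
    calc _ ≤ ∑' k : ℤ, ENNReal.ofReal (C * J ^ (1 / (n + 1 : ℝ))) *
          ∫⁻ p in A k, ENNReal.ofReal (gradH2 n g p) := by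
          refine ENNReal.tsum_le_tsum fun k => ?_
          exact hC g hg J hJpos (2 ^ k) (by positivity) (markov _ (by positivity))
      _ = _ := ENNReal.tsum_mul_left
      _ ≤ _ := by gcongr
  rw [ENNReal.ofReal_le_ofReal_iff (by positivity)] at fin
  have hsplit : J = J ^ ((n : ℝ) / (n + 1)) * J ^ (1 / (n + 1 : ℝ)) := by
    rw [← Real.rpow_add hJpos, ← add_div, div_self (by positivity), Real.rpow_one]
  have hJ1 : 0 < J ^ (1 / (n + 1 : ℝ)) := by positivity
  refine le_of_mul_le_mul_right ?_ hJ1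
  rw [← hsplit]
  calc J ≤ _ := fin
    _ = _ := by ring

/-- derivative along a horizontal field -/
def Dh (n : ℕ) (a b : Fin n → ℝ) (f : Hspace n → ℝ) (p : Hspace n) : ℝ :=
  fderiv ℝ f p (Vf n a b p)

lemma haar_inst (n : ℕ) : (volume : Measure (Hspace n)).IsAddHaarMeasure := by
  have h1 : (volume : Measure ((Fin n → ℝ) × ℝ)).IsAddHaarMeasure := by
    rw [Measure.volume_eq_prod]
    exact Measure.prod.instIsAddHaarMeasure volume volume
  rw [Measure.volume_eq_prod]
  exact Measure.prod.instIsAddHaarMeasure volume volume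

lemma integral_Dh_zero (n : ℕ) (a b : Fin n → ℝ) (f : Hspace n → ℝ) (hf : ContDiff ℝ 1 f)
    (hc : HasCompactSupport f) : ∫ p, Dh n a b f p = 0 := by
  have := haar_inst n
  have hfd : Differentiable ℝ f := hf.differentiable one_ne_zero
  have key : ∀ (c : Hspace n → ℝ) (v : Hspace n), ContDiff ℝ 1 c → (∀ p, fderiv ℝ c p v = 0) →
      ∫ p, c p * fderiv ℝ f p v = 0 := by
    intro c v hcc hcv
    have hcf : HasCompactSupport (fun p => fderiv ℝ f p v) := hc.fderiv_apply ℝ v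
    have h1 : Continuous (fun p => fderiv ℝ f p v) :=
      (hf.continuous_fderiv one_ne_zero).clm_apply continuous_const
    have h2 : Continuous (fun p => fderiv ℝ c p v) :=
      (hcc.continuous_fderiv one_ne_zero).clm_apply continuous_const
    rw [integral_mul_fderiv_eq_neg_fderiv_mul_of_integrable (v := v) (f := c) (g := f)
      (μ := volume)]
    · simp [hcv]
    · exact (h2.mul hf.continuous).integrable_of_hasCompactSupport hc.mul_left
    · exact (hcc.continuous.mul h1).integrable_of_hasCompactSupport hcf.mul_left
    · exact (hcc.continuous.mul hf.continuous).integrable_of_hasCompactSupport hc.mul_left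
    · exact fun p _ => (hcc.differentiable one_ne_zero) p
    · exact fun p _ => hfd p
  set c : Hspace n → ℝ := fun p => 2 * ∑ j, (p.2.1 j * a j - p.1 j * b j) with hcdef
  have hcc : ContDiff ℝ 1 c := by rw [hcdef]; fun_prop
  have hv : ∀ p, Dh n a b f p = 1 * fderiv ℝ f p (a, b, 0) + c p * fderiv ℝ f p (0, 0, 1) := by
    intro p
    have : Vf n a b p = (a, b, 0) + c p • ((0, 0, 1) : Hspace n) := by simp [Vf, hcdef]
    rw [Dh, this, map_add, map_smul, smul_eq_mul, one_mul]
  simp_rw [hv]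
  have i1 : Continuous (fun p => fderiv ℝ f p ((a, b, 0) : Hspace n)) :=
      (hf.continuous_fderiv one_ne_zero).clm_apply continuous_const
  have i2 : Continuous (fun p => fderiv ℝ f p ((0, 0, 1) : Hspace n)) :=
      (hf.continuous_fderiv one_ne_zero).clm_apply continuous_const
  rw [integral_add]
  · rw [key (fun _ => 1) _ contDiff_const (by simp), key c _ hcc, add_zero]
    intro p
    have hd : HasLineDerivAt ℝ c 0 p ((0, 0, 1) : Hspace n) := by
      unfold HasLineDerivAt
      have : (fun t : ℝ => c (p + t • ((0, 0, 1) : Hspace n))) = fun _ => c p := by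
        ext t; simp [hcdef]
      rw [this]; exact hasDerivAt_const _ _
    exact (((hcc.differentiable one_ne_zero) p).hasFDerivAt.hasLineDerivAt _).unique hd
  · exact (continuous_const.mul i1).integrable_of_hasCompactSupport (hc.fderiv_apply ℝ _).mul_left
  · exact (hcc.continuous.mul i2).integrable_of_hasCompactSupport (hc.fderiv_apply ℝ _).mul_left

/-- integrability of things supported in `tsupport u`, continuous away from zero -/
lemma integ_of (n : ℕ) (u F : Hspace n → ℝ) (hc : HasCompactSupport u)
    (h0 : (0 : Hspace n) ∉ tsupport u) (hF : ∀ p, p ≠ 0 → ContinuousAt F p)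
    (hs : ∀ p, p ∉ tsupport u → F p = 0) : Continuous F ∧ HasCompactSupport F ∧ Integrable F := by
  have hsub : tsupport F ⊆ tsupport u := by
    refine closure_minimal ?_ (isClosed_tsupport u)
    intro p hp
    by_contra hp'
    exact hp (hs p hp')
  have hcF : HasCompactSupport F := hc.of_isClosed_subset (isClosed_tsupport F) hsub
  have hcont : Continuous F := by
    refine continuous_of_tsupport fun p hp => hF p ?_
    rintro rfl
    exact h0 (hsub hp)
  exact ⟨hcont, hcF, hcont.integrable_of_hasCompactSupport hcF⟩

lemma Dh_zero_off (n : ℕ) (a b : Fin n → ℝ) (u : Hspace n → ℝ) (p : Hspace n)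
    (hp : p ∉ tsupport u) : Dh n a b u p = 0 := by
  have : fderiv ℝ u p = 0 := by
    by_contra h
    exact hp (support_fderiv_subset ℝ h)
  simp [Dh, this]

lemma tsupport_Dh (n : ℕ) (a b : Fin n → ℝ) (u : Hspace n → ℝ) :
    tsupport (Dh n a b u) ⊆ tsupport u := by
  refine closure_minimal ?_ (isClosed_tsupport u)
  intro p hp
  by_contra hp'
  exact hp (Dh_zero_off n a b u p hp')

lemma contDiff_of_ts (n : ℕ) (f : Hspace n → ℝ) (h : ∀ p ∈ tsupport f, ContDiffAt ℝ 1 f p) :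
    ContDiff ℝ 1 f := by
  rw [contDiff_iff_contDiffAt]
  intro p
  by_cases hp : p ∈ tsupport f
  · exact h p hp
  · exact (contDiffAt_const (c := (0:ℝ))).congr_of_eventuallyEq
      (notMem_tsupport_iff_eventuallyEq.mp hp)

/-- integration by parts against a weight smooth away from zero -/
lemma ibp1 (n : ℕ) (a b : Fin n → ℝ) (ψ v : Hspace n → ℝ)
    (hψ : ∀ p, p ≠ 0 → ContDiffAt ℝ 1 ψ p) (hv : ContDiff ℝ 1 v) (hc : HasCompactSupport v)
    (h0 : (0 : Hspace n) ∉ tsupport v) :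
    Integrable (fun p => ψ p * Dh n a b v p) ∧ Integrable (fun p => Dh n a b ψ p * v p) ∧
    ∫ p, ψ p * Dh n a b v p = - ∫ p, Dh n a b ψ p * v p := by
  have i1 : Integrable (fun p => ψ p * Dh n a b v p) := by
    refine (integ_of n v _ hc h0 (fun p hp => ?_) (fun p hp => ?_)).2.2
    · exact (hψ p hp).continuousAt.mul (continuous_fderiv_Vf n a b v hv).continuousAt
    · simp [Dh_zero_off n a b v p hp]
  have i2 : Integrable (fun p => Dh n a b ψ p * v p) := by
    refine (integ_of n v _ hc h0 (fun p hp => ?_) (fun p hp => ?_)).2.2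
    · refine ContinuousAt.mul ?_ hv.continuous.continuousAt
      exact ((hψ p hp).continuousAt_fderiv one_ne_zero).clm_apply (continuous_Vf n a b).continuousAt
    · simp [image_eq_zero_of_notMem_tsupport hp]
  refine ⟨i1, i2, ?_⟩
  have hts : tsupport (fun p => ψ p * v p) ⊆ tsupport v := tsupport_mul_subset_right
  have hfc : ContDiff ℝ 1 (fun p => ψ p * v p) := by
    refine contDiff_of_ts n _ fun p hp => ?_
    refine (hψ p ?_).mul hv.contDiffAt
    rintro rfl; exact h0 (hts hp)
  have hz := integral_Dh_zero n a b _ hfc (hc.mul_left)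
  have : ∀ p, Dh n a b (fun p => ψ p * v p) p = ψ p * Dh n a b v p + Dh n a b ψ p * v p := by
    intro p
    by_cases hp : p ∈ tsupport v
    · have hp0 : p ≠ 0 := by rintro rfl; exact h0 hp
      have := ((hψ p hp0).differentiableAt one_ne_zero).hasFDerivAt.mul
        ((hv.differentiable one_ne_zero) p).hasFDerivAt
      have h3 : Dh n a b (fun p => ψ p * v p) p = _ :=
        congrArg (fun L => L (Vf n a b p)) (HasFDerivAt.fderiv this)
      rw [h3]
      simp [Dh]; ring
    · rw [Dh_zero_off _ _ _ _ _ (fun h => hp (hts h)), Dh_zero_off n a b v p hp,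
        image_eq_zero_of_notMem_tsupport hp]
      simp
  simp_rw [this] at hz
  rw [integral_add i1 i2] at hz
  linarith

lemma Dh_comp (n : ℕ) (a b : Fin n → ℝ) (u : Hspace n → ℝ) (P : ℝ → ℝ) (d : ℝ) (p : Hspace n)
    (hu : DifferentiableAt ℝ u p) (hP : HasDerivAt P d (u p)) :
    Dh n a b (fun p => P (u p)) p = d * Dh n a b u p := by
  have := hP.comp_hasFDerivAt p hu.hasFDerivAt
  have h3 : Dh n a b (fun p => P (u p)) p = _ :=
    congrArg (fun L => L (Vf n a b p)) (HasFDerivAt.fderiv this)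
  rw [h3]; simp [Dh]

lemma contDiff_Dh (n : ℕ) (a b : Fin n → ℝ) (u : Hspace n → ℝ) (hu : ContDiff ℝ 2 u) :
    ContDiff ℝ 1 (Dh n a b u) := by
  unfold Dh
  exact (hu.fderiv_right (m := 1) (by norm_num)).clm_apply (contDiff_Vf n a b)

/-- the basic identity in one direction -/
lemma ibp_id (n : ℕ) (a b : Fin n → ℝ) (u ψ q : Hspace n → ℝ) (P h k : ℝ → ℝ)
    (hu : ContDiff ℝ 2 u) (hc : HasCompactSupport u) (h0 : (0 : Hspace n) ∉ tsupport u)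
    (hψ : ∀ p, p ≠ 0 → ContDiffAt ℝ 1 ψ p) (hq : ∀ p, p ≠ 0 → ContDiffAt ℝ 1 q p)
    (hψq : ∀ p, p ≠ 0 → Dh n a b ψ p = q p)
    (hP : ∀ x, HasDerivAt P (h x) x) (hh : ∀ x, HasDerivAt h (k x) x) (hk : Continuous k)
    (hP0 : P 0 = 0) :
    Integrable (fun p => ψ p * (k (u p) * Dh n a b u p ^ 2 + h (u p) * Dh n a b (Dh n a b u) p)) ∧
    Integrable (fun p => Dh n a b q p * P (u p)) ∧
    ∫ p, ψ p * (k (u p) * Dh n a b u p ^ 2 + h (u p) * Dh n a b (Dh n a b u) p) =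
      ∫ p, Dh n a b q p * P (u p) := by
  have hu1 : ContDiff ℝ 1 u := hu.of_le (by norm_num)
  have hud : Differentiable ℝ u := hu1.differentiable one_ne_zero
  have hhc : ContDiff ℝ 1 h := by
    rw [contDiff_one_iff_deriv]
    refine ⟨fun x => (hh x).differentiableAt, ?_⟩
    rwa [show deriv h = k from funext fun x => (hh x).deriv]
  have hPc : ContDiff ℝ 1 P := by
    rw [contDiff_one_iff_deriv]
    refine ⟨fun x => (hP x).differentiableAt, ?_⟩
    rw [show deriv P = h from funext fun x => (hP x).deriv]
    exact hhc.continuous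
  have hDu := contDiff_Dh n a b u hu
  have tsub : ∀ w : Hspace n → ℝ, (∀ p, p ∉ tsupport u → w p = 0) → tsupport w ⊆ tsupport u := by
    intro w hw
    refine closure_minimal ?_ (isClosed_tsupport u)
    intro p hp
    by_contra hp'
    exact hp (hw p hp')
  have t1 := tsub (fun p => h (u p) * Dh n a b u p)
    (fun p hp => by simp [Dh_zero_off n a b u p hp])
  have t2 := tsub (fun p => P (u p))
    (fun p hp => by simp [image_eq_zero_of_notMem_tsupport hp, hP0])
  obtain ⟨A1, A2, A3⟩ := ibp1 n a b ψ (fun p => h (u p) * Dh n a b u p) hψ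
    ((hhc.comp hu1).mul hDu) (hc.of_isClosed_subset (isClosed_tsupport _) t1) (fun hh => h0 (t1 hh))
  obtain ⟨B1, B2, B3⟩ := ibp1 n a b q (fun p => P (u p)) hq
    (hPc.comp hu1) (hc.of_isClosed_subset (isClosed_tsupport _) t2) (fun hh => h0 (t2 hh))
  have e1 : ∀ p, Dh n a b (fun p => h (u p) * Dh n a b u p) p =
      k (u p) * Dh n a b u p ^ 2 + h (u p) * Dh n a b (Dh n a b u) p := by
    intro p
    have := ((hh (u p)).comp_hasFDerivAt p (hud p).hasFDerivAt).mul
      ((hDu.differentiable one_ne_zero) p).hasFDerivAt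
    have h3 : Dh n a b (fun p => h (u p) * Dh n a b u p) p = _ :=
      congrArg (fun L => L (Vf n a b p)) (HasFDerivAt.fderiv this)
    rw [h3]
    simp only [Dh, Function.comp, add_apply, smul_apply, smul_eq_mul]
    ring
  simp_rw [e1] at A1 A3
  refine ⟨A1, B2, ?_⟩
  have e2 : ∀ p, Dh n a b (fun p => P (u p)) p = h (u p) * Dh n a b u p :=
    fun p => Dh_comp n a b u P _ p (hud p) (hP _)
  simp_rw [e2] at B3
  rw [A3, neg_eq_iff_eq_neg, ← B3]
  refine integral_congr_ae ?_
  filter_upwards [] with p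
  by_cases hp : p ∈ tsupport u
  · rw [hψq p (by rintro rfl; exact h0 hp)]
  · simp [Dh_zero_off n a b u p hp]

lemma Xd_Dh (n : ℕ) (j : Fin n) (f : Hspace n → ℝ) : Xd n j f = Dh n (Pi.single j 1) 0 f :=
  funext (Xd_eq n j f)
lemma Yd_Dh (n : ℕ) (j : Fin n) (f : Hspace n → ℝ) : Yd n j f = Dh n 0 (Pi.single j 1) f :=
  funext (Yd_eq n j f)

def cc (n : ℕ) (a b : Fin n → ℝ) (p : Hspace n) : ℝ := ∑ j, (p.1 j * a j + p.2.1 j * b j)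
def tau (n : ℕ) (a b : Fin n → ℝ) (p : Hspace n) : ℝ := 2 * ∑ j, (p.2.1 j * a j - p.1 j * b j)
def NN (n : ℕ) (p : Hspace n) : ℝ := zSq n p ^ 2 + p.2.2 ^ 2

lemma zSq_nonneg (n : ℕ) (p : Hspace n) : 0 ≤ zSq n p :=
  Finset.sum_nonneg fun _ _ => by positivity

lemma NN_nonneg (n : ℕ) (p : Hspace n) : 0 ≤ NN n p := by unfold NN; positivity

lemma NN_pos (n : ℕ) (p : Hspace n) (hp : p ≠ 0) : 0 < NN n p := by
  rcases (NN_nonneg n p).eq_or_lt with h | h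
  · exfalso
    apply hp
    unfold NN at h
    have h1 : zSq n p = 0 := by nlinarith [sq_nonneg (zSq n p), sq_nonneg p.2.2]
    have h2 : p.2.2 = 0 := by nlinarith [sq_nonneg (zSq n p), sq_nonneg p.2.2]
    unfold zSq at h1
    rw [Finset.sum_eq_zero_iff_of_nonneg (fun _ _ => by positivity)] at h1
    ext j
    · have := h1 j (Finset.mem_univ _); simp; nlinarith [sq_nonneg (p.1 j), sq_nonneg (p.2.1 j)]
    · have := h1 j (Finset.mem_univ _); simp; nlinarith [sq_nonneg (p.1 j), sq_nonneg (p.2.1 j)]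
    · simpa using h2
  · exact h

lemma contDiff_zSq (n : ℕ) {k : WithTop ℕ∞} : ContDiff ℝ k (zSq n) := by unfold zSq; fun_prop
lemma contDiff_NN (n : ℕ) {k : WithTop ℕ∞} : ContDiff ℝ k (NN n) := by
  unfold NN; have := contDiff_zSq n (k := k); fun_prop
lemma contDiff_cc (n : ℕ) (a b) {k : WithTop ℕ∞} : ContDiff ℝ k (cc n a b) := by unfold cc; fun_prop
lemma contDiff_tau (n : ℕ) (a b) {k : WithTop ℕ∞} : ContDiff ℝ k (tau n a b) := by
  unfold tau; fun_prop

lemma zSq_flow (n : ℕ) (a b : Fin n → ℝ) (p : Hspace n) (s : ℝ) :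
    zSq n (p + s • Vf n a b p) = zSq n p + 2 * cc n a b p * s + ab2 n a b * s ^ 2 := by
  simp only [zSq, cc, ab2, Vf, Finset.mul_sum, Finset.sum_mul, ← Finset.sum_add_distrib]
  refine Finset.sum_congr rfl fun j _ => ?_
  simp; ring

lemma cc_flow (n : ℕ) (a b : Fin n → ℝ) (p : Hspace n) (s : ℝ) :
    cc n a b (p + s • Vf n a b p) = cc n a b p + ab2 n a b * s := by
  simp only [cc, ab2, Vf, Finset.mul_sum, Finset.sum_mul, ← Finset.sum_add_distrib]
  refine Finset.sum_congr rfl fun j _ => ?_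
  simp; ring

lemma tau_flow (n : ℕ) (a b : Fin n → ℝ) (p : Hspace n) (s : ℝ) :
    tau n a b (p + s • Vf n a b p) = tau n a b p := by
  simp only [tau, Vf]
  congr 1
  refine Finset.sum_congr rfl fun j _ => ?_
  simp; ring

lemma t_flow (n : ℕ) (a b : Fin n → ℝ) (p : Hspace n) (s : ℝ) :
    (p + s • Vf n a b p).2.2 = p.2.2 + tau n a b p * s := by
  simp [tau, Vf]; ring

lemma Dh_of_line (n : ℕ) (a b : Fin n → ℝ) (f : Hspace n → ℝ) (p : Hspace n) (d : ℝ)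
    (hf : DifferentiableAt ℝ f p) (h : HasDerivAt (fun s : ℝ => f (p + s • Vf n a b p)) d 0) :
    Dh n a b f p = d :=
  (hf.hasFDerivAt.hasLineDerivAt (Vf n a b p)).unique h

section line
variable (n : ℕ) (a b : Fin n → ℝ) (p : Hspace n)

lemma line_z : HasDerivAt (fun s : ℝ => zSq n (p + s • Vf n a b p)) (2 * cc n a b p) 0 := by
  simp_rw [zSq_flow]
  have h1 : HasDerivAt (fun s : ℝ => s) 1 0 := hasDerivAt_id' 0
  refine HasDerivAt.congr_deriv ((((h1.const_mul (2 * cc n a b p)).const_add (zSq n p)).add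
    ((h1.pow 2).const_mul (ab2 n a b)))) ?_
  simp

lemma line_c : HasDerivAt (fun s : ℝ => cc n a b (p + s • Vf n a b p)) (ab2 n a b) 0 := by
  simp_rw [cc_flow]
  have h1 : HasDerivAt (fun s : ℝ => s) 1 0 := hasDerivAt_id' 0
  refine HasDerivAt.congr_deriv (((h1.const_mul (ab2 n a b)).const_add (cc n a b p))) ?_
  simp

lemma line_tau : HasDerivAt (fun s : ℝ => tau n a b (p + s • Vf n a b p)) 0 0 := by
  simp_rw [tau_flow]
  exact hasDerivAt_const _ _

lemma line_t : HasDerivAt (fun s : ℝ => (p + s • Vf n a b p).2.2) (tau n a b p) 0 := by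
  simp_rw [t_flow]
  have h1 : HasDerivAt (fun s : ℝ => s) 1 0 := hasDerivAt_id' 0
  refine HasDerivAt.congr_deriv (((h1.const_mul (tau n a b p)).const_add (p.2.2))) ?_
  simp

lemma line_N : HasDerivAt (fun s : ℝ => NN n (p + s • Vf n a b p))
    (4 * zSq n p * cc n a b p + 2 * p.2.2 * tau n a b p) 0 := by
  unfold NN
  refine HasDerivAt.congr_deriv (((line_z n a b p).pow 2).add ((line_t n a b p).pow 2)) ?_
  simp; ring
end line

def EE (n : ℕ) (e β δ : ℝ) (a b : Fin n → ℝ) (p : Hspace n) : ℝ :=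
  e * (4 * zSq n p * cc n a b p + 2 * p.2.2 * tau n a b p) / NN n p
    - 2 * β * cc n a b p / (zSq n p + δ)

def psi (n : ℕ) (e β δ : ℝ) (p : Hspace n) : ℝ := NN n p ^ e * (zSq n p + δ) ^ (-β)

def DE (n : ℕ) (e β δ : ℝ) (a b : Fin n → ℝ) (p : Hspace n) : ℝ :=
  e * ((8 * cc n a b p ^ 2 + 4 * zSq n p * ab2 n a b + 2 * tau n a b p ^ 2) / NN n p
    - (4 * zSq n p * cc n a b p + 2 * p.2.2 * tau n a b p) ^ 2 / NN n p ^ 2)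
    - 2 * β * ab2 n a b / (zSq n p + δ) + 4 * β * cc n a b p ^ 2 / (zSq n p + δ) ^ 2

lemma contDiffAt_psi (n : ℕ) (e β δ : ℝ) (hδ : 0 < δ) (p : Hspace n) (hp : p ≠ 0) :
    ContDiffAt ℝ 1 (psi n e β δ) p := by
  have h1 : zSq n p + δ ≠ 0 := by have := zSq_nonneg n p; positivity
  unfold psi
  exact ((contDiff_NN n).contDiffAt.rpow_const_of_ne (NN_pos n p hp).ne').mul
    (((contDiff_zSq n).contDiffAt.add contDiffAt_const).rpow_const_of_ne h1)

lemma contDiffAt_EE (n : ℕ) (e β δ : ℝ) (hδ : 0 < δ) (a b) (p : Hspace n) (hp : p ≠ 0) :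
    ContDiffAt ℝ 1 (EE n e β δ a b) p := by
  have h1 : zSq n p + δ ≠ 0 := by have := zSq_nonneg n p; positivity
  unfold EE
  have hz := (contDiff_zSq n (k := 1)).contDiffAt (x := p)
  have hN := (contDiff_NN n (k := 1)).contDiffAt (x := p)
  have hc := (contDiff_cc n a b (k := 1)).contDiffAt (x := p)
  have ht := (contDiff_tau n a b (k := 1)).contDiffAt (x := p)
  have ht2 : ContDiffAt ℝ 1 (fun p : Hspace n => p.2.2) p := by fun_prop
  exact ((contDiffAt_const.mul (((contDiffAt_const.mul hz).mul hc).add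
    ((contDiffAt_const.mul ht2).mul ht))).div hN (NN_pos n p hp).ne').sub
    ((contDiffAt_const.mul hc).div (hz.add contDiffAt_const) h1)

lemma line_psi (n : ℕ) (e β δ : ℝ) (hδ : 0 < δ) (a b) (p : Hspace n) (hp : p ≠ 0) :
    HasDerivAt (fun s : ℝ => psi n e β δ (p + s • Vf n a b p))
      (psi n e β δ p * EE n e β δ a b p) 0 := by
  have hz : 0 < zSq n p + δ := by have := zSq_nonneg n p; positivity
  have hN := NN_pos n p hp
  unfold psi
  refine HasDerivAt.congr_deriv (((line_N n a b p).rpow_const (p := e) (by left; simpa using hN.ne')).mul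
    (((line_z n a b p).add_const δ).rpow_const (p := -β) (by left; simpa using hz.ne'))) ?_
  simp only [zero_smul, add_zero]
  rw [rpow_sub_one hN.ne', rpow_sub_one hz.ne', EE]
  field_simp
  ring

lemma line_EE (n : ℕ) (e β δ : ℝ) (hδ : 0 < δ) (a b) (p : Hspace n) (hp : p ≠ 0) :
    HasDerivAt (fun s : ℝ => EE n e β δ a b (p + s • Vf n a b p)) (DE n e β δ a b p) 0 := by
  have hz : 0 < zSq n p + δ := by have := zSq_nonneg n p; positivity
  have hN := NN_pos n p hp
  unfold EE
  have h1 := ((((line_z n a b p).const_mul 4).mul (line_c n a b p)).add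
    (((line_t n a b p).const_mul 2).mul (line_tau n a b p))).const_mul e
  have h2 := h1.div (line_N n a b p) (by simpa using hN.ne')
  have h3 := ((line_c n a b p).const_mul (2 * β)).div ((line_z n a b p).add_const δ)
    (by simpa using hz.ne')
  refine HasDerivAt.congr_deriv (h2.sub h3) ?_
  simp only [zero_smul, add_zero, DE, Pi.add_apply, Pi.mul_apply]
  field_simp
  ring

lemma Dh_psi (n : ℕ) (e β δ : ℝ) (hδ : 0 < δ) (a b) (p : Hspace n) (hp : p ≠ 0) :
    Dh n a b (psi n e β δ) p = psi n e β δ p * EE n e β δ a b p :=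
  Dh_of_line _ _ _ _ _ _ ((contDiffAt_psi n e β δ hδ p hp).differentiableAt one_ne_zero)
    (line_psi n e β δ hδ a b p hp)

lemma Dh_q (n : ℕ) (e β δ : ℝ) (hδ : 0 < δ) (a b) (p : Hspace n) (hp : p ≠ 0) :
    Dh n a b (fun p => psi n e β δ p * EE n e β δ a b p) p =
      psi n e β δ p * (EE n e β δ a b p ^ 2 + DE n e β δ a b p) := by
  refine Dh_of_line _ _ _ _ _ _ (((contDiffAt_psi n e β δ hδ p hp).mul
    (contDiffAt_EE n e β δ hδ a b p hp)).differentiableAt one_ne_zero) ?_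
  refine HasDerivAt.congr_deriv ((line_psi n e β δ hδ a b p hp).mul (line_EE n e β δ hδ a b p hp)) ?_
  simp only [zero_smul, add_zero]
  ring

lemma cc_X (n j) (p : Hspace n) : cc n (Pi.single j 1) 0 p = p.1 j := by
  simp [cc, Pi.single_apply]
lemma cc_Y (n j) (p : Hspace n) : cc n 0 (Pi.single j 1) p = p.2.1 j := by
  simp [cc, Pi.single_apply]
lemma tau_X (n j) (p : Hspace n) : tau n (Pi.single j 1) 0 p = 2 * p.2.1 j := by
  simp [tau, Pi.single_apply]
lemma tau_Y (n j) (p : Hspace n) : tau n 0 (Pi.single j 1) p = - (2 * p.1 j) := by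
  simp [tau, Pi.single_apply]

/-- `Δψ/ψ` -/
def LL (n : ℕ) (e β δ : ℝ) (p : Hspace n) : ℝ :=
  8 * e * n * zSq n p / NN n p + 16 * e ^ 2 * zSq n p / NN n p
    - 16 * e * β * zSq n p ^ 2 / (NN n p * (zSq n p + δ)) - 4 * β * n / (zSq n p + δ)
    + 4 * β * (1 + β) * zSq n p / (zSq n p + δ) ^ 2

def E2 (n : ℕ) (e β δ : ℝ) (p : Hspace n) : ℝ :=
  16 * e ^ 2 * zSq n p / NN n p
    - 16 * e * β * zSq n p ^ 2 / (NN n p * (zSq n p + δ))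
    + 4 * β ^ 2 * zSq n p / (zSq n p + δ) ^ 2

lemma sum_EE_sq (n : ℕ) (e β δ : ℝ) (hδ : 0 < δ) (p : Hspace n) (hp : p ≠ 0) :
    ∑ j : Fin n, (EE n e β δ (Pi.single j 1) 0 p ^ 2 + EE n e β δ 0 (Pi.single j 1) p ^ 2) =
      E2 n e β δ p := by
  have hz : 0 < zSq n p + δ := by have := zSq_nonneg n p; positivity
  have hN := NN_pos n p hp
  have key : ∀ j : Fin n, EE n e β δ (Pi.single j 1) 0 p ^ 2 + EE n e β δ 0 (Pi.single j 1) p ^ 2 =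
      ((p.1 j) ^ 2 + (p.2.1 j) ^ 2) * (16 * e ^ 2 / NN n p
    - 16 * e * β * zSq n p / (NN n p * (zSq n p + δ)) + 4 * β ^ 2 / (zSq n p + δ) ^ 2) := by
    intro j
    simp only [EE, cc_X, cc_Y, tau_X, tau_Y]
    field_simp
    simp only [NN]
    ring
  simp_rw [key, ← Finset.sum_mul]
  rw [← zSq, E2]
  ring

lemma sum_DE (n : ℕ) (e β δ : ℝ) (hδ : 0 < δ) (p : Hspace n) (hp : p ≠ 0) :
    ∑ j : Fin n, (DE n e β δ (Pi.single j 1) 0 p + DE n e β δ 0 (Pi.single j 1) p) =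
      8 * e * n * zSq n p / NN n p - 4 * β * n / (zSq n p + δ)
      + 4 * β * zSq n p / (zSq n p + δ) ^ 2 := by
  have hz : 0 < zSq n p + δ := by have := zSq_nonneg n p; positivity
  have hN := NN_pos n p hp
  have key : ∀ j : Fin n, DE n e β δ (Pi.single j 1) 0 p + DE n e β δ 0 (Pi.single j 1) p =
      ((p.1 j) ^ 2 + (p.2.1 j) ^ 2) * (4 * β / (zSq n p + δ) ^ 2) +
        (8 * e * zSq n p / NN n p - 4 * β / (zSq n p + δ)) := by
    intro j
    simp only [DE, cc_X, cc_Y, tau_X, tau_Y, ab2_single_left, ab2_single_right]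
    field_simp
    simp only [NN]
    ring
  simp_rw [key, Finset.sum_add_distrib, ← Finset.sum_mul]
  rw [← zSq]
  simp
  ring

lemma continuous_lapH (n : ℕ) (u : Hspace n → ℝ) (hu : ContDiff ℝ 2 u) :
    Continuous (lapH n u) := by
  unfold lapH
  refine continuous_finsetSum _ fun j _ => ?_
  simp only [Xd_Dh, Yd_Dh]
  exact (continuous_fderiv_Vf n _ _ _ (contDiff_Dh n _ _ u hu)).add
    (continuous_fderiv_Vf n _ _ _ (contDiff_Dh n _ _ u hu))

lemma lapH_off (n : ℕ) (u : Hspace n → ℝ) (p : Hspace n) (hp : p ∉ tsupport u) :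
    lapH n u p = 0 := by
  unfold lapH
  refine Finset.sum_eq_zero fun j _ => ?_
  simp only [Xd_Dh, Yd_Dh]
  rw [Dh_zero_off _ _ _ _ _ (fun h => hp (tsupport_Dh n _ _ u h)),
    Dh_zero_off _ _ _ _ _ (fun h => hp (tsupport_Dh n _ _ u h)), add_zero]

lemma gradH2_off (n : ℕ) (u : Hspace n → ℝ) (p : Hspace n) (hp : p ∉ tsupport u) :
    gradH2 n u p = 0 := by
  unfold gradH2
  refine Finset.sum_eq_zero fun j _ => ?_
  simp only [Xd_Dh, Yd_Dh]
  rw [Dh_zero_off _ _ _ _ _ hp, Dh_zero_off _ _ _ _ _ hp]; simp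

lemma ibp_sum (n : ℕ) (u : Hspace n → ℝ) (P h k : ℝ → ℝ) (e β δ : ℝ) (hδ : 0 < δ)
    (hu : ContDiff ℝ 2 u) (hc : HasCompactSupport u) (h0 : (0 : Hspace n) ∉ tsupport u)
    (hP : ∀ x, HasDerivAt P (h x) x) (hh : ∀ x, HasDerivAt h (k x) x) (hk : Continuous k)
    (hP0 : P 0 = 0) :
    Integrable (fun p => psi n e β δ p * (LL n e β δ p * P (u p))) ∧
    ∫ p, psi n e β δ p * (k (u p) * gradH2 n u p + h (u p) * lapH n u p) =
      ∫ p, psi n e β δ p * (LL n e β δ p * P (u p)) := by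
  have main := fun a b => ibp_id n a b u (psi n e β δ) (fun p => psi n e β δ p * EE n e β δ a b p)
    P h k hu hc h0 (contDiffAt_psi n e β δ hδ)
    (fun p hp => (contDiffAt_psi n e β δ hδ p hp).mul (contDiffAt_EE n e β δ hδ a b p hp))
    (Dh_psi n e β δ hδ a b) hP hh hk hP0
  have eL : ∀ p, psi n e β δ p * (k (u p) * gradH2 n u p + h (u p) * lapH n u p) =
      ∑ j : Fin n, ((psi n e β δ p * (k (u p) * Dh n (Pi.single j 1) 0 u p ^ 2 +
        h (u p) * Dh n (Pi.single j 1) 0 (Dh n (Pi.single j 1) 0 u) p)) +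
        (psi n e β δ p * (k (u p) * Dh n 0 (Pi.single j 1) u p ^ 2 +
        h (u p) * Dh n 0 (Pi.single j 1) (Dh n 0 (Pi.single j 1) u) p))) := by
    intro p
    simp only [gradH2, lapH, Xd_Dh, Yd_Dh, Finset.mul_sum, ← Finset.sum_add_distrib]
    refine Finset.sum_congr rfl fun j _ => ?_
    ring
  have eR : ∀ p, psi n e β δ p * (LL n e β δ p * P (u p)) =
      ∑ j : Fin n, (Dh n (Pi.single j 1) 0
          (fun p => psi n e β δ p * EE n e β δ (Pi.single j 1) 0 p) p * P (u p) +
        Dh n 0 (Pi.single j 1)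
          (fun p => psi n e β δ p * EE n e β δ 0 (Pi.single j 1) p) p * P (u p)) := by
    intro p
    by_cases hp : p = 0
    · have : u p = 0 := image_eq_zero_of_notMem_tsupport (by rwa [hp])
      simp [this, hP0]
    · simp only [Dh_q n e β δ hδ _ _ p hp]
      have h1 := sum_EE_sq n e β δ hδ p hp
      have h2 := sum_DE n e β δ hδ p hp
      have : ∑ j : Fin n, (psi n e β δ p * (EE n e β δ (Pi.single j 1) 0 p ^ 2 +
            DE n e β δ (Pi.single j 1) 0 p) * P (u p) +
          psi n e β δ p * (EE n e β δ 0 (Pi.single j 1) p ^ 2 +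
            DE n e β δ 0 (Pi.single j 1) p) * P (u p)) =
          psi n e β δ p * P (u p) *
          (∑ j : Fin n, (EE n e β δ (Pi.single j 1) 0 p ^ 2 + EE n e β δ 0 (Pi.single j 1) p ^ 2) +
          ∑ j : Fin n, (DE n e β δ (Pi.single j 1) 0 p + DE n e β δ 0 (Pi.single j 1) p)) := by
        simp only [Finset.mul_sum, ← Finset.sum_add_distrib]
        refine Finset.sum_congr rfl fun j _ => ?_
        ring
      rw [this, h1, h2, E2, LL]
      ring
  simp_rw [eL, eR]
  constructor
  · exact integrable_finsetSum _ fun j _ => (main _ _).2.1.add (main _ _).2.1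
  · rw [integral_finsetSum, integral_finsetSum]
    · refine Finset.sum_congr rfl fun j _ => ?_
      rw [integral_add (main _ _).1 (main _ _).1, integral_add (main _ _).2.1 (main _ _).2.1,
        (main _ _).2.2, (main _ _).2.2]
    · exact fun j _ => (main _ _).2.1.add (main _ _).2.1
    · exact fun j _ => (main _ _).1.add (main _ _).1

lemma ae_zSq (n : ℕ) (hn : 1 ≤ n) : ∀ᵐ p : Hspace n, 0 < zSq n p := by
  have := haar_inst n
  let j : Fin n := ⟨0, hn⟩
  let L : Hspace n →ₗ[ℝ] ℝ := (LinearMap.proj j) ∘ₗ (LinearMap.fst ℝ _ _)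
  have h : volume ((LinearMap.ker L : Submodule ℝ (Hspace n)) : Set (Hspace n)) = 0 := by
    apply Measure.addHaar_submodule
    intro h
    have : ((Pi.single j 1, 0, 0) : Hspace n) ∈ LinearMap.ker L := by rw [h]; trivial
    simp [L] at this
  rw [ae_iff]
  refine measure_mono_null ?_ h
  intro p hp
  have hp' : zSq n p = 0 := le_antisymm (not_lt.mp hp) (zSq_nonneg n p)
  unfold zSq at hp'
  rw [Finset.sum_eq_zero_iff_of_nonneg (fun _ _ => by positivity)] at hp'
  have := hp' j (Finset.mem_univ _)
  show L p = 0
  simp only [L, LinearMap.comp_apply, LinearMap.proj_apply, LinearMap.fst_apply]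
  nlinarith [sq_nonneg (p.1 j), sq_nonneg (p.2.1 j)]

/-- the weight `ρ²/|z|²` -/
def Wt (n : ℕ) (p : Hspace n) : ℝ := NN n p ^ (1/2 : ℝ) / zSq n p

lemma Wt_nonneg (n : ℕ) (p : Hspace n) : 0 ≤ Wt n p :=
  div_nonneg (rpow_nonneg (NN_nonneg n p) _) (zSq_nonneg n p)

lemma NN_of_z (n : ℕ) (p : Hspace n) (h : 0 < zSq n p) : 0 < NN n p := by unfold NN; positivity

lemma contAt_NN_rpow (n : ℕ) (e : ℝ) (p : Hspace n) (hp : p ≠ 0) :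
    ContinuousAt (fun p => NN n p ^ e) p :=
  (contDiff_NN n (k := 1)).continuous.continuousAt.rpow_const (Or.inl (NN_pos n p hp).ne')

lemma rpow_half_facts {N : ℝ} (hN : 0 < N) : 0 < N ^ (1/2 : ℝ) ∧ (N ^ (1/2:ℝ)) ^ 2 = N ∧
    N ^ (-(1/2) : ℝ) = (N ^ (1/2 : ℝ))⁻¹ := by
  refine ⟨by positivity, ?_, rpow_neg hN.le _⟩
  rw [← rpow_natCast, ← rpow_mul hN.le]; norm_num

lemma rellich (n : ℕ) (hn : 2 ≤ n) (u : Hspace n → ℝ)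
    (hu : ContDiff ℝ 2 u) (hc : HasCompactSupport u) (h0 : (0 : Hspace n) ∉ tsupport u)
    (hA : Integrable (fun p => Wt n p * lapH n u p ^ 2)) :
    Integrable (fun p => zSq n p * NN n p ^ (-(3/2) : ℝ) * u p ^ 2) ∧
    (2 * n - 2 : ℝ) ^ 2 * ∫ p, zSq n p * NN n p ^ (-(3/2) : ℝ) * u p ^ 2 ≤
      ∫ p, Wt n p * lapH n u p ^ 2 := by
  have hn' : (2:ℝ) ≤ n := by exact_mod_cast hn
  set m : ℝ := 2 * n - 2 with hm
  have hm0 : 0 < m := by linarith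
  have iI : Integrable (fun p => zSq n p * NN n p ^ (-(3/2) : ℝ) * u p ^ 2) := by
    refine (integ_of n u _ hc h0 (fun p hp => ?_) (fun p hp => ?_)).2.2
    · exact ((contDiff_zSq n (k := 1)).continuous.continuousAt.mul (contAt_NN_rpow n _ p hp)).mul
        (hu.continuous.continuousAt.pow 2)
    · simp [image_eq_zero_of_notMem_tsupport hp]
  refine ⟨iI, ?_⟩
  obtain ⟨_, h2⟩ := ibp_sum n u (fun x => x ^ 2 / 2) (fun x => x) (fun _ => 1) (-(1/2)) 0 1 one_pos
    hu hc h0 (fun x => by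
      have := (hasDerivAt_pow 2 x).div_const 2
      simpa using this) (fun x => hasDerivAt_id' x) continuous_const (by norm_num)
  have iL : Integrable (fun p => psi n (-(1/2)) 0 1 p * (1 * gradH2 n u p + u p * lapH n u p)) := by
    refine (integ_of n u _ hc h0 (fun p hp => ?_) (fun p hp => ?_)).2.2
    · exact (contDiffAt_psi n _ _ _ one_pos p hp).continuousAt.mul
        ((continuous_const.mul (continuous_gradH2 n u (hu.of_le (by norm_num)))).add
          (hu.continuous.mul (continuous_lapH n u hu))).continuousAt
    · simp [image_eq_zero_of_notMem_tsupport hp, gradH2_off n u p hp]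
  have e2 : ∀ᵐ p : Hspace n, psi n (-(1/2)) 0 1 p * (LL n (-(1/2)) 0 1 p * (u p ^ 2 / 2)) =
      (-m) * (zSq n p * NN n p ^ (-(3/2) : ℝ) * u p ^ 2) := by
    filter_upwards [ae_zSq n (by omega)] with p hp
    have hN := NN_of_z n p hp
    have : NN n p ^ (-(3/2) : ℝ) = NN n p ^ (-(1/2) : ℝ) / NN n p := by
      rw [← rpow_sub_one hN.ne']; norm_num
    rw [this, psi, LL]
    simp only [neg_zero, rpow_zero]
    field_simp
    ring
  rw [integral_congr_ae e2, integral_const_mul] at h2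
  have h3 : ∫ p, (-(m/2) * (zSq n p * NN n p ^ (-(3/2) : ℝ) * u p ^ 2) -
      1 / (2 * m) * (Wt n p * lapH n u p ^ 2)) ≤
      ∫ p, psi n (-(1/2)) 0 1 p * (1 * gradH2 n u p + u p * lapH n u p) := by
    refine integral_mono_ae ((iI.const_mul _).sub (hA.const_mul _)) iL ?_
    filter_upwards [ae_zSq n (by omega)] with p hp
    have hN := NN_of_z n p hp
    obtain ⟨a1, a2, a3⟩ := rpow_half_facts hN
    have : NN n p ^ (-(3/2) : ℝ) = NN n p ^ (-(1/2) : ℝ) / NN n p := by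
      rw [← rpow_sub_one hN.ne']; norm_num
    rw [this, psi, Wt, a3]
    simp only [neg_zero, rpow_zero, mul_one, one_mul]
    set r := NN n p ^ (1/2 : ℝ)
    rw [← a2]
    have hg := gradH2_nonneg n u p
    set G := gradH2 n u p
    set z := zSq n p
    set L := lapH n u p
    have : r⁻¹ * (G + u p * L) - (-(m/2) * (z * (r⁻¹ / r^2) * u p ^ 2) - 1 / (2 * m) * (r / z * L ^ 2))
      = r⁻¹ * G + (m * u p * z / r ^ 2 + L) ^ 2 * (r / (2 * m * z)) := by
      field_simp; ring
    have h5 : 0 ≤ r⁻¹ * G + (m * u p * z / r ^ 2 + L) ^ 2 * (r / (2 * m * z)) := by positivity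
    show _ ≤ _
    linarith
  rw [integral_sub (iI.const_mul _) (hA.const_mul _), integral_const_mul, integral_const_mul] at h3
  set I := ∫ p, zSq n p * NN n p ^ (-(3/2) : ℝ) * u p ^ 2
  set A := ∫ p, Wt n p * lapH n u p ^ 2
  have h4 : -(m/2) * I - 1 / (2*m) * A ≤ -m * I := by linarith
  have h5 : m / 2 * I ≤ 1 / (2*m) * A := by linarith
  have h6 := mul_le_mul_of_nonneg_left h5 (show 0 ≤ 2 * m by positivity)
  have h7 : 2 * m * (1 / (2*m) * A) = A := by field_simp
  nlinarith

lemma hasDeriv_h (r : ℝ) (hr : 0 < r) (x : ℝ) :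
    HasDerivAt (fun x : ℝ => |x| ^ r * x) ((r + 1) * |x| ^ r) x := by
  by_cases hx : x = 0
  · subst hx
    rw [hasDerivAt_iff_tendsto_slope]
    have h1 : Filter.Tendsto (fun x : ℝ => |x| ^ r) (nhdsWithin 0 {0}ᶜ) (nhds ((r+1) * |0| ^ r)) := by
      have : (r + 1) * |(0:ℝ)| ^ r = |(0:ℝ)| ^ r := by simp [zero_rpow hr.ne']
      rw [this]
      have hc : Continuous (fun x : ℝ => |x| ^ r) := continuous_abs.rpow_const (fun _ => Or.inr hr.le)
      exact (hc.tendsto 0).mono_left nhdsWithin_le_nhds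
    refine h1.congr' ?_
    filter_upwards [self_mem_nhdsWithin] with y hy
    have hy : y ≠ 0 := hy
    simp [slope_def_field, hy]
  · have h1 := ((hasDerivAt_abs hx).rpow_const (p := r) (Or.inl (abs_ne_zero.mpr hx))).mul
      (hasDerivAt_id' x)
    refine h1.congr_deriv ?_
    rw [rpow_sub_one (abs_ne_zero.mpr hx)]
    have : (SignType.sign x : ℝ) * x = |x| := by
      rcases lt_or_gt_of_ne hx with h | h
      · simp [sign_neg h, abs_of_neg h]
      · simp [sign_pos h, abs_of_pos h]
    have hx' := abs_ne_zero.mpr hx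
    have e : (SignType.sign x : ℝ) * r * (|x| ^ r / |x|) * x
      = r * |x| ^ r * (((SignType.sign x : ℝ) * x) / |x|) := by ring
    rw [e, this, div_self hx']
    ring

lemma hasDeriv_P (r : ℝ) (hr : 0 < r) (x : ℝ) :
    HasDerivAt (fun x : ℝ => |x| ^ (r + 2) / (r + 2)) (|x| ^ r * x) x := by
  refine ((hasDerivAt_abs_rpow x (p := r + 2) (by linarith)).div_const (r + 2)).congr_deriv ?_
  rw [show r + 2 - 2 = r by ring]
  field_simp

/-- regularised weight -/
def wd (n : ℕ) (δ : ℝ) (p : Hspace n) : ℝ := NN n p ^ (1/2 : ℝ) / (zSq n p + δ)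

lemma contAt_wd (n : ℕ) (δ : ℝ) (hδ : 0 < δ) (p : Hspace n) (hp : p ≠ 0) :
    ContinuousAt (wd n δ) p := by
  have h1 : zSq n p + δ ≠ 0 := by have := zSq_nonneg n p; positivity
  exact (contAt_NN_rpow n _ p hp).div
    ((contDiff_zSq n (k := 1)).continuous.continuousAt.add continuousAt_const) h1

lemma contAt_LL (n : ℕ) (e β δ : ℝ) (hδ : 0 < δ) (p : Hspace n) (hp : p ≠ 0) :
    ContinuousAt (LL n e β δ) p := by
  have h1 : zSq n p + δ ≠ 0 := by have := zSq_nonneg n p; positivity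
  have h2 := (NN_pos n p hp).ne'
  have hz := (contDiff_zSq n (k := 1)).continuous.continuousAt (x := p)
  have hN := (contDiff_NN n (k := 1)).continuous.continuousAt (x := p)
  have h3 := mul_ne_zero h2 h1
  have h4 := pow_ne_zero 2 h1
  unfold LL
  fun_prop (disch := assumption)

lemma cont_abs_rpow (n : ℕ) (r : ℝ) (hr : 0 ≤ r) (u : Hspace n → ℝ) (hu : Continuous u) :
    Continuous (fun p => |u p| ^ r) := hu.abs.rpow_const (fun _ => Or.inr hr)

lemma sq_h (r x : ℝ) (hr : 0 < r) : (|x| ^ r * x) ^ 2 = |x| ^ (2 * r + 2) := by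
  rw [mul_pow, ← sq_abs x, show 2 * r + 2 = r + r + 1 + 1 by ring,
    rpow_add_one' (abs_nonneg _) (by positivity), rpow_add_one' (abs_nonneg _) (by positivity),
    rpow_add' (abs_nonneg _) (by positivity)]
  ring

lemma NN_half_ge (n : ℕ) (p : Hspace n) : zSq n p ≤ NN n p ^ (1/2 : ℝ) := by
  rw [← sqrt_eq_rpow]
  apply le_sqrt_of_sq_le
  unfold NN
  nlinarith [sq_nonneg p.2.2]

lemma psi_eq_wd (n : ℕ) (β δ : ℝ) (hδ : 0 < δ) (p : Hspace n) :
    psi n (β / 2) β δ p = wd n δ p ^ β := by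
  have hz : 0 < zSq n p + δ := by have := zSq_nonneg n p; positivity
  have hN := NN_nonneg n p
  rw [wd, div_rpow (by positivity) hz.le, ← rpow_mul hN, psi, rpow_neg hz.le, div_eq_mul_inv]
  congr 2; ring

lemma wd_pos (n : ℕ) (δ : ℝ) (hδ : 0 < δ) (p : Hspace n) (hp : p ≠ 0) : 0 < wd n δ p := by
  have hz : 0 < zSq n p + δ := by have := zSq_nonneg n p; positivity
  have hN := NN_pos n p hp
  unfold wd; positivity

lemma wd_nonneg (n : ℕ) (δ : ℝ) (hδ : 0 < δ) (p : Hspace n) : 0 ≤ wd n δ p := by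
  have hz : 0 < zSq n p + δ := by have := zSq_nonneg n p; positivity
  have hN := NN_nonneg n p
  unfold wd; positivity

lemma psi_nonneg (n : ℕ) (e β δ : ℝ) (hδ : 0 < δ) (p : Hspace n) : 0 ≤ psi n e β δ p := by
  have hz : 0 < zSq n p + δ := by have := zSq_nonneg n p; positivity
  have hN := NN_nonneg n p
  unfold psi; positivity

lemma psi_case (n : ℕ) (β δ : ℝ) (hδ : 0 < δ) (hb0 : 0 ≤ β) (hb1 : β ≤ 1) (p : Hspace n) :
    psi n (β / 2) β δ p ≤ 1 ∨ psi n (β / 2) β δ p ≤ wd n δ p := by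
  rw [psi_eq_wd n β δ hδ]
  rcases le_total (wd n δ p) 1 with h | h
  · left; exact rpow_le_one (wd_nonneg n δ hδ p) h hb0
  · right
    calc wd n δ p ^ β ≤ wd n δ p ^ (1:ℝ) := rpow_le_rpow_of_exponent_le h hb1
      _ = _ := rpow_one _

lemma wd_facts (n : ℕ) (δ : ℝ) (hδ : 0 < δ) (p : Hspace n) (hz : 0 < zSq n p)
    (hd : δ ≤ NN n p ^ (1/2 : ℝ)) : 1 ≤ 2 * wd n δ p ∧ wd n δ p ≤ Wt n p ∧ 1 ≤ Wt n p := by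
  have h1 := NN_half_ge n p
  refine ⟨?_, ?_, ?_⟩
  · rw [wd, ← mul_div_assoc, le_div_iff₀ (by positivity)]; linarith
  · unfold wd Wt
    have : 0 ≤ NN n p ^ (1/2 : ℝ) := by linarith
    gcongr
    linarith
  · rw [Wt, le_div_iff₀ hz]; linarith

lemma psi_sq_le (n : ℕ) (β δ : ℝ) (hδ : 0 < δ) (hb0 : 0 ≤ β) (hb1 : β ≤ 1) (p : Hspace n)
    (hz : 0 < zSq n p) (hd : δ ≤ NN n p ^ (1/2 : ℝ)) :
    psi n (β / 2) β δ p ^ 2 ≤ 3 * wd n δ p * Wt n p := by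
  obtain ⟨h1, h2, h3⟩ := wd_facts n δ hδ p hz hd
  have h0 := psi_nonneg n (β/2) β δ hδ p
  have hw := wd_nonneg n δ hδ p
  rcases psi_case n β δ hδ hb0 hb1 p with h | h
  · nlinarith
  · nlinarith

lemma psi_z_le (n : ℕ) (β δ : ℝ) (hδ : 0 < δ) (hb0 : 0 ≤ β) (hb1 : β ≤ 1) (p : Hspace n)
    (hp : p ≠ 0) : psi n (β / 2) β δ p * (zSq n p / NN n p) ≤ NN n p ^ (-(1/2) : ℝ) := by
  have hN := NN_pos n p hp
  obtain ⟨a1, a2, a3⟩ := rpow_half_facts hN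
  have hz := zSq_nonneg n p
  have h1 := NN_half_ge n p
  rw [a3]
  have key : ∀ y, psi n (β / 2) β δ p ≤ y → y * (zSq n p / NN n p) ≤ (NN n p ^ (1/2 : ℝ))⁻¹ →
     psi n (β / 2) β δ p * (zSq n p / NN n p) ≤ (NN n p ^ (1/2 : ℝ))⁻¹ := fun y h h' =>
       le_trans (mul_le_mul_of_nonneg_right h (by positivity)) h'
  rcases psi_case n β δ hδ hb0 hb1 p with h | h
  · refine key _ h ?_
    nth_rewrite 1 [← a2]
    rw [one_mul, div_le_iff₀ (by positivity), pow_two, inv_mul_cancel_left₀ a1.ne']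
    exact h1
  · refine key _ h ?_
    rw [wd]
    nth_rewrite 2 [← a2]
    set R := NN n p ^ (1/2 : ℝ)
    have : R / (zSq n p + δ) * (zSq n p / R ^ 2) = R⁻¹ * (zSq n p / (zSq n p + δ)) := by
      field_simp
    rw [this]
    apply mul_le_of_le_one_right (by positivity)
    rw [div_le_one (by positivity)]; linarith

/-- the nonlinear test -/
lemma nl_test (n : ℕ) (hn : 1 ≤ n) (u : Hspace n → ℝ) (r e β δ' δ l : ℝ) (hr : 0 < r)
    (hδ' : 0 < δ') (hδ : 0 < δ) (hl : 0 < l)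
    (hu : ContDiff ℝ 2 u) (hc : HasCompactSupport u) (h0 : (0 : Hspace n) ∉ tsupport u)
    (hA : Integrable (fun p => Wt n p * lapH n u p ^ 2))
    (hψ : ∀ p ∈ tsupport u, 0 < zSq n p → psi n e β δ' p ^ 2 ≤ 3 * wd n δ p * Wt n p) :
    (r + 1) * ∫ p, psi n e β δ' p * (|u p| ^ r * gradH2 n u p) ≤
      l / 2 * (∫ p, Wt n p * lapH n u p ^ 2) + 3 / (2 * l) * (∫ p, wd n δ p * |u p| ^ (2 * r + 2))
      + ∫ p, psi n e β δ' p * (LL n e β δ' p * (|u p| ^ (r + 2) / (r + 2))) := by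
  have hu1 : ContDiff ℝ 1 u := hu.of_le (by norm_num)
  have hcr := cont_abs_rpow n r hr.le u hu.continuous
  obtain ⟨_, h2⟩ := ibp_sum n u (fun x => |x| ^ (r + 2) / (r + 2)) (fun x => |x| ^ r * x)
    (fun x => (r + 1) * |x| ^ r) e β δ' hδ' hu hc h0 (hasDeriv_P r hr) (hasDeriv_h r hr)
    (continuous_const.mul (continuous_abs.rpow_const (fun _ => Or.inr hr.le)))
    (by simp [zero_rpow (show r + 2 ≠ 0 by positivity)])
  have i1 : Integrable (fun p => psi n e β δ' p * (|u p| ^ r * gradH2 n u p)) := by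
    refine (integ_of n u _ hc h0 (fun p hp => ?_) (fun p hp => ?_)).2.2
    · exact (contDiffAt_psi n _ _ _ hδ' p hp).continuousAt.mul
        (hcr.mul (continuous_gradH2 n u hu1)).continuousAt
    · simp [gradH2_off n u p hp]
  have i2 : Integrable (fun p => psi n e β δ' p * (|u p| ^ r * u p * lapH n u p)) := by
    refine (integ_of n u _ hc h0 (fun p hp => ?_) (fun p hp => ?_)).2.2
    · exact (contDiffAt_psi n _ _ _ hδ' p hp).continuousAt.mul
        ((hcr.mul hu.continuous).mul (continuous_lapH n u hu)).continuousAt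
    · simp [image_eq_zero_of_notMem_tsupport hp]
  have i3 : Integrable (fun p => wd n δ p * |u p| ^ (2 * r + 2)) := by
    refine (integ_of n u _ hc h0 (fun p hp => ?_) (fun p hp => ?_)).2.2
    · exact (contAt_wd n δ hδ p hp).mul
        (cont_abs_rpow n _ (by positivity) u hu.continuous).continuousAt
    · simp [image_eq_zero_of_notMem_tsupport hp, zero_rpow (show 2 * r + 2 ≠ 0 by positivity)]
  have e1 : ∀ p, psi n e β δ' p * ((r + 1) * |u p| ^ r * gradH2 n u p + |u p| ^ r * u p * lapH n u p)
      = (r + 1) * (psi n e β δ' p * (|u p| ^ r * gradH2 n u p)) +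
        psi n e β δ' p * (|u p| ^ r * u p * lapH n u p) := fun p => by ring
  simp_rw [e1] at h2
  rw [integral_add (i1.const_mul _) i2, integral_const_mul] at h2
  have h3 : ∫ p, (-(l/2) * (Wt n p * lapH n u p ^ 2) +
      -(3 / (2 * l)) * (wd n δ p * |u p| ^ (2 * r + 2))) ≤
      ∫ p, psi n e β δ' p * (|u p| ^ r * u p * lapH n u p) := by
    refine integral_mono_ae ((hA.const_mul _).add (i3.const_mul _)) i2 ?_
    filter_upwards [ae_zSq n hn] with p hp
    show _ ≤ _
    by_cases hpu : p ∈ tsupport u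
    · have hq := hψ p hpu hp
      have hN := NN_of_z n p hp
      have hW : 0 < Wt n p := by unfold Wt; positivity
      rw [← sq_h r _ hr]
      set H := |u p| ^ r * u p
      set L := lapH n u p
      set W := Wt n p
      set w := wd n δ p
      set ψ := psi n e β δ' p
      have : ψ * (H * L) - (-(l/2) * (W * L ^ 2) + -(3 / (2 * l)) * (w * H ^ 2)) =
        (1 / (2 * l * W)) * ((l * W * L + ψ * H) ^ 2 + (3 * w * W - ψ ^ 2) * H ^ 2) := by
        field_simp; ring
      have h5 : 0 ≤ (1 / (2 * l * W)) * ((l * W * L + ψ * H) ^ 2 + (3 * w * W - ψ ^ 2) * H ^ 2) := by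
        have : 0 ≤ (3 * w * W - ψ ^ 2) * H ^ 2 := mul_nonneg (by linarith) (sq_nonneg _)
        positivity
      linarith
    · simp [image_eq_zero_of_notMem_tsupport hpu, lapH_off n u p hpu,
        zero_rpow (show 2 * r + 2 ≠ 0 by positivity)]
  rw [integral_add (hA.const_mul _) (i3.const_mul _), integral_const_mul, integral_const_mul] at h3
  linarith

lemma integ_NN (n : ℕ) (u : Hspace n → ℝ) (e r : ℝ) (hr : 0 < r)
    (hu : Continuous u) (hc : HasCompactSupport u) (h0 : (0 : Hspace n) ∉ tsupport u) :
    Integrable (fun p => NN n p ^ e * |u p| ^ r) := by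
  refine (integ_of n u _ hc h0 (fun p hp => ?_) (fun p hp => ?_)).2.2
  · exact (contAt_NN_rpow n e p hp).mul (cont_abs_rpow n r hr.le u hu).continuousAt
  · simp [image_eq_zero_of_notMem_tsupport hp, zero_rpow hr.ne']

lemma hardy (n : ℕ) (hn : 2 ≤ n) (u : Hspace n → ℝ) (r : ℝ) (hr : 0 < r)
    (hu : ContDiff ℝ 2 u) (hc : HasCompactSupport u) (h0 : (0 : Hspace n) ∉ tsupport u) :
    ∫ p, NN n p ^ (-(1/2) : ℝ) * |u p| ^ (r + 2) ≤
      (r + 2) ^ 2 / 4 * ∫ p, |u p| ^ r * gradH2 n u p := by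
  have hn' : (2:ℝ) ≤ n := by exact_mod_cast hn
  have hu1 : ContDiff ℝ 1 u := hu.of_le (by norm_num)
  have hud : Differentiable ℝ u := hu1.differentiable one_ne_zero
  have hcr := cont_abs_rpow n r hr.le u hu.continuous
  have hr2 : r + 2 ≠ 0 := by positivity
  set φ : Hspace n → ℝ := psi n (-(1/2)) 0 1 with hφ
  have hφe : ∀ p, φ p = NN n p ^ (-(1/2) : ℝ) := fun p => by simp [hφ, psi]
  set v : Hspace n → ℝ := fun p => |u p| ^ (r + 2) with hv
  have hPd : ∀ x : ℝ, HasDerivAt (fun x : ℝ => |x| ^ (r+2)) ((r + 2) * |x| ^ r * x) x := by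
    intro x
    have := hasDerivAt_abs_rpow x (p := r + 2) (by linarith)
    rwa [show r + 2 - 2 = r by ring] at this
  have hvc : ContDiff ℝ 1 v := by
    have : ContDiff ℝ 1 (fun x : ℝ => |x| ^ (r+2)) := by
      rw [contDiff_one_iff_deriv]
      refine ⟨fun x => (hPd x).differentiableAt, ?_⟩
      rw [funext fun x => (hPd x).deriv]
      exact (continuous_const.mul (continuous_abs.rpow_const (fun _ => Or.inr hr.le))).mul
        continuous_id
    exact this.comp hu1
  have hvs : tsupport v ⊆ tsupport u := by
    refine closure_minimal ?_ (isClosed_tsupport u)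
    intro p hp
    by_contra hp'
    exact hp (by simp [hv, image_eq_zero_of_notMem_tsupport hp', zero_rpow hr2])
  have hDv : ∀ a b p, Dh n a b v p = (r + 2) * |u p| ^ r * u p * Dh n a b u p :=
    fun a b p => Dh_comp n a b u _ _ p (hud p) (hPd _)
  have main := fun a b => ibp1 n a b (fun p => φ p * cc n a b p) v
    (fun p hp => (contDiffAt_psi n _ _ _ one_pos p hp).mul (contDiff_cc n a b).contDiffAt)
    hvc (hc.of_isClosed_subset (isClosed_tsupport _) hvs) (fun h => h0 (hvs h))
  have hDq : ∀ a b p, p ≠ 0 → Dh n a b (fun p => φ p * cc n a b p) p =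
      φ p * (EE n (-(1/2)) 0 1 a b p * cc n a b p + ab2 n a b) := by
    intro a b p hp
    refine Dh_of_line _ _ _ _ _ _ (((contDiffAt_psi n _ _ _ one_pos p hp).mul
      (contDiff_cc n a b).contDiffAt).differentiableAt one_ne_zero) ?_
    refine ((line_psi n (-(1/2)) 0 1 one_pos a b p hp).mul (line_c n a b p)).congr_deriv ?_
    simp only [zero_smul, add_zero]
    rw [hφ]; ring
  -- sum
  have S1 : ∫ p, ∑ j : Fin n, (φ p * cc n (Pi.single j 1) 0 p * Dh n (Pi.single j 1) 0 v p +
      φ p * cc n 0 (Pi.single j 1) p * Dh n 0 (Pi.single j 1) v p) =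
      - ∫ p, ∑ j : Fin n, (Dh n (Pi.single j 1) 0 (fun p => φ p * cc n (Pi.single j 1) 0 p) p * v p +
      Dh n 0 (Pi.single j 1) (fun p => φ p * cc n 0 (Pi.single j 1) p) p * v p) := by
    rw [integral_finsetSum, integral_finsetSum, ← Finset.sum_neg_distrib]
    · refine Finset.sum_congr rfl fun j _ => ?_
      rw [integral_add (main _ _).1 (main _ _).1, integral_add (main _ _).2.1 (main _ _).2.1,
        (main _ _).2.2, (main _ _).2.2]
      ring
    · exact fun j _ => (main _ _).2.1.add (main _ _).2.1
    · exact fun j _ => (main _ _).1.add (main _ _).1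
  have eL : ∀ p, ∑ j : Fin n, (φ p * cc n (Pi.single j 1) 0 p * Dh n (Pi.single j 1) 0 v p +
      φ p * cc n 0 (Pi.single j 1) p * Dh n 0 (Pi.single j 1) v p) =
      φ p * ((r + 2) * (|u p| ^ r * u p)) * fderiv ℝ u p (Vf n p.1 p.2.1 p) := by
    intro p
    rw [fderiv_Vf, Finset.mul_sum]
    refine Finset.sum_congr rfl fun j _ => ?_
    rw [hDv, hDv, cc_X, cc_Y, Xd_Dh, Yd_Dh]; ring
  have eR : ∀ p, p ≠ 0 → ∑ j : Fin n, (Dh n (Pi.single j 1) 0 (fun p => φ p * cc n (Pi.single j 1) 0 p) p * v p +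
      Dh n 0 (Pi.single j 1) (fun p => φ p * cc n 0 (Pi.single j 1) p) p * v p) =
      φ p * v p * (2 * n - 2 * (zSq n p ^ 2 / NN n p)) := by
    intro p hp
    have hN := NN_pos n p hp
    have key : ∀ j : Fin n, (Dh n (Pi.single j 1) 0 (fun p => φ p * cc n (Pi.single j 1) 0 p) p * v p +
      Dh n 0 (Pi.single j 1) (fun p => φ p * cc n 0 (Pi.single j 1) p) p * v p) =
       φ p * v p * (2 - 2 * (zSq n p / NN n p) * (p.1 j ^ 2 + p.2.1 j ^ 2)) := by
      intro j
      rw [hDq _ _ p hp, hDq _ _ p hp]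
      simp only [EE, cc_X, cc_Y, tau_X, tau_Y, ab2_single_left, ab2_single_right]
      field_simp
      ring
    simp_rw [key]
    rw [← Finset.mul_sum, Finset.sum_sub_distrib, ← Finset.mul_sum, ← zSq]
    simp
    ring_nf
    simp
  simp_rw [eL] at S1
  have iH : Integrable (fun p => NN n p ^ (-(1/2) : ℝ) * |u p| ^ (r + 2)) :=
    integ_NN n u _ _ (by positivity) hu.continuous hc h0
  have iI : Integrable (fun p => |u p| ^ r * gradH2 n u p) := by
    refine (integ_of n u _ hc h0 (fun p hp => ?_) (fun p hp => ?_)).2.2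
    · exact (hcr.mul (continuous_gradH2 n u hu1)).continuousAt
    · simp [gradH2_off n u p hp]
  have iL : Integrable (fun p => φ p * ((r + 2) * (|u p| ^ r * u p)) * fderiv ℝ u p (Vf n p.1 p.2.1 p)) := by
    have : Integrable (fun p => ∑ j : Fin n, (φ p * cc n (Pi.single j 1) 0 p * Dh n (Pi.single j 1) 0 v p +
      φ p * cc n 0 (Pi.single j 1) p * Dh n 0 (Pi.single j 1) v p)) :=
      integrable_finsetSum _ fun j _ => (main _ _).1.add (main _ _).1
    simpa only [eL] using this
  have iR : Integrable (fun p => ∑ j : Fin n, (Dh n (Pi.single j 1) 0 (fun p => φ p * cc n (Pi.single j 1) 0 p) p * v p +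
      Dh n 0 (Pi.single j 1) (fun p => φ p * cc n 0 (Pi.single j 1) p) p * v p)) :=
      integrable_finsetSum _ fun j _ => (main _ _).2.1.add (main _ _).2.1
  have hR : (2 * n - 2 : ℝ) * ∫ p, NN n p ^ (-(1/2) : ℝ) * |u p| ^ (r + 2) ≤
      ∫ p, ∑ j : Fin n, (Dh n (Pi.single j 1) 0 (fun p => φ p * cc n (Pi.single j 1) 0 p) p * v p +
      Dh n 0 (Pi.single j 1) (fun p => φ p * cc n 0 (Pi.single j 1) p) p * v p) := by
    rw [← integral_const_mul]
    refine integral_mono_ae (iH.const_mul _) iR ?_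
    filter_upwards [ae_zSq n (by omega)] with p hp
    have hp0 : p ≠ 0 := by rintro rfl; simp [zSq] at hp
    have hN := NN_pos n p hp0
    show _ ≤ _
    rw [eR p hp0, hφe]
    have h1 : zSq n p ^ 2 / NN n p ≤ 1 := by
      rw [div_le_one hN]; unfold NN; nlinarith [sq_nonneg p.2.2]
    have h2 : 0 ≤ NN n p ^ (-(1/2) : ℝ) * |u p| ^ (r + 2) := by positivity
    have h3 := mul_le_mul_of_nonneg_left (show (2 * n - 2 : ℝ) ≤ 2 * n - 2 * (zSq n p ^ 2 / NN n p) by linarith) h2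
    simp only [hv]
    linarith
  have hL : ∫ p, (-1 * (NN n p ^ (-(1/2) : ℝ) * |u p| ^ (r + 2)) + -((r+2)^2/4) * (|u p| ^ r * gradH2 n u p)) ≤
     ∫ p, φ p * ((r + 2) * (|u p| ^ r * u p)) * fderiv ℝ u p (Vf n p.1 p.2.1 p) := by
    refine integral_mono_ae ((iH.const_mul _).add (iI.const_mul _)) iL ?_
    filter_upwards [ae_zSq n (by omega)] with p hp
    have hN := NN_of_z n p hp
    show _ ≤ _
    have hS := fderiv_Vf_sq_le n p.1 p.2.1 u p
    have hab : ab2 n p.1 p.2.1 = zSq n p := rfl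
    rw [hab] at hS
    obtain ⟨a1, a2, a3⟩ := rpow_half_facts hN
    rw [hφe, a3]
    have hzR := NN_half_ge n p
    have hG := gradH2_nonneg n u p
    rw [show r + 2 = r + 1 + 1 by ring, rpow_add_one' (abs_nonneg _) (by positivity),
      rpow_add_one' (abs_nonneg _) (by positivity), mul_assoc (|u p| ^ r), ← sq, sq_abs]
    have hUr : 0 ≤ |u p| ^ r := by positivity
    set S := fderiv ℝ u p (Vf n p.1 p.2.1 p)
    set R := NN n p ^ (1/2 : ℝ)
    set G := gradH2 n u p
    set U := |u p| ^ r
    have hS2 : S ^ 2 / R ≤ G := by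
      rw [div_le_iff₀ a1]
      nlinarith
    have : R⁻¹ * ((r+1+1) * (U * u p)) * S - (-1 * (R⁻¹ * (U * u p ^ 2)) + -((r+1+1)^2/4) * (U * G)) =
      U * (R⁻¹ * (u p + (r+2)/2 * S) ^ 2 + (r+2)^2/4 * (G - S ^ 2 / R)) := by
      field_simp; ring
    have h5 : 0 ≤ U * (R⁻¹ * (u p + (r+2)/2 * S) ^ 2 + (r+2)^2/4 * (G - S ^ 2 / R)) := by
      have : 0 ≤ G - S ^ 2 / R := by linarith
      positivity
    linarith
  rw [integral_add (iH.const_mul _) (iI.const_mul _), integral_const_mul, integral_const_mul] at hL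
  have hH0 : 0 ≤ ∫ p, NN n p ^ (-(1/2) : ℝ) * |u p| ^ (r + 2) := integral_nonneg fun p => by
    have := NN_nonneg n p
    positivity
  nlinarith

lemma psi_half_sq (n : ℕ) (β δ : ℝ) (hδ : 0 < δ) (p : Hspace n) :
    psi n (β / 4) (β / 2) δ p ^ 2 = psi n (β / 2) β δ p := by
  have hz : 0 < zSq n p + δ := by have := zSq_nonneg n p; positivity
  have hN := NN_nonneg n p
  rw [psi, psi, mul_pow, ← rpow_natCast, ← rpow_natCast, ← rpow_mul hN, ← rpow_mul hz.le]
  congr 2 <;> push_cast <;> ring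

/-- the three weighted integrands -/
lemma integ_pack (n : ℕ) (u : Hspace n → ℝ) (r e β δ : ℝ) (hr : 0 < r) (hδ : 0 < δ)
    (hu : ContDiff ℝ 2 u) (hc : HasCompactSupport u) (h0 : (0 : Hspace n) ∉ tsupport u) :
    Integrable (fun p => psi n e β δ p * (|u p| ^ r * gradH2 n u p)) ∧
    Integrable (fun p => psi n e β δ p / (zSq n p + δ) * |u p| ^ (r + 2)) ∧
    Integrable (fun p => wd n δ p * |u p| ^ (2 * r + 2)) := by
  have hu1 : ContDiff ℝ 1 u := hu.of_le (by norm_num)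
  have hcr := cont_abs_rpow n r hr.le u hu.continuous
  refine ⟨?_, ?_, ?_⟩
  · refine (integ_of n u _ hc h0 (fun p hp => ?_) (fun p hp => ?_)).2.2
    · exact (contDiffAt_psi n _ _ _ hδ p hp).continuousAt.mul
        (hcr.mul (continuous_gradH2 n u hu1)).continuousAt
    · simp [gradH2_off n u p hp]
  · refine (integ_of n u _ hc h0 (fun p hp => ?_) (fun p hp => ?_)).2.2
    · have h1 : zSq n p + δ ≠ 0 := by have := zSq_nonneg n p; positivity
      exact ((contDiffAt_psi n _ _ _ hδ p hp).continuousAt.div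
        ((contDiff_zSq n (k := 1)).continuous.continuousAt.add continuousAt_const) h1).mul
        (cont_abs_rpow n _ (by positivity) u hu.continuous).continuousAt
    · simp [image_eq_zero_of_notMem_tsupport hp, zero_rpow (show r + 2 ≠ 0 by positivity)]
  · refine (integ_of n u _ hc h0 (fun p hp => ?_) (fun p hp => ?_)).2.2
    · exact (contAt_wd n δ hδ p hp).mul
        (cont_abs_rpow n _ (by positivity) u hu.continuous).continuousAt
    · simp [image_eq_zero_of_notMem_tsupport hp, zero_rpow (show 2 * r + 2 ≠ 0 by positivity)]

lemma psi_test (n : ℕ) (hn : 2 ≤ n) (u : Hspace n → ℝ) (r β δ l : ℝ) (hr : 0 < r)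
    (hδ : 0 < δ) (hb0 : 0 ≤ β) (hb1 : β ≤ 1) (hl : 0 < l)
    (hu : ContDiff ℝ 2 u) (hc : HasCompactSupport u) (h0 : (0 : Hspace n) ∉ tsupport u)
    (hA : Integrable (fun p => Wt n p * lapH n u p ^ 2))
    (hd : ∀ p ∈ tsupport u, δ ≤ NN n p ^ (1/2 : ℝ)) :
    (r + 1) * (∫ p, psi n (β/2) β δ p * (|u p| ^ r * gradH2 n u p)) +
      (4 * β * (n - 1 - β)) / (r + 2) * ∫ p, psi n (β/2) β δ p / (zSq n p + δ) * |u p| ^ (r + 2) ≤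
      l / 2 * (∫ p, Wt n p * lapH n u p ^ 2) + 3 / (2 * l) * (∫ p, wd n δ p * |u p| ^ (2 * r + 2))
      + (4 * β * n + 4 * β ^ 2) / (r + 2) * ∫ p, NN n p ^ (-(1/2) : ℝ) * |u p| ^ (r + 2) := by
  have h1 := nl_test n (by omega) u r (β/2) β δ δ l hr hδ hδ hl hu hc h0 hA
    (fun p hp hz => psi_sq_le n β δ hδ hb0 hb1 p hz (hd p hp))
  obtain ⟨_, i2, _⟩ := integ_pack n u r (β/2) β δ hr hδ hu hc h0
  have i3 := integ_NN n u (-(1/2)) (r+2) (by positivity) hu.continuous hc h0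
  have i4 : Integrable (fun p => psi n (β/2) β δ p * (LL n (β/2) β δ p * (|u p| ^ (r + 2) / (r + 2)))) := by
    refine (integ_of n u _ hc h0 (fun p hp => ?_) (fun p hp => ?_)).2.2
    · exact (contDiffAt_psi n _ _ _ hδ p hp).continuousAt.mul
        ((contAt_LL n _ _ _ hδ p hp).mul
        ((cont_abs_rpow n _ (by positivity) u hu.continuous).div_const _).continuousAt)
    · simp [image_eq_zero_of_notMem_tsupport hp, zero_rpow (show r + 2 ≠ 0 by positivity)]
  have h2 : ∫ p, psi n (β/2) β δ p * (LL n (β/2) β δ p * (|u p| ^ (r + 2) / (r + 2))) ≤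
      ∫ p, ((4 * β * n + 4 * β ^ 2) / (r + 2) * (NN n p ^ (-(1/2) : ℝ) * |u p| ^ (r + 2)) +
        -((4 * β * (n - 1 - β)) / (r + 2)) * (psi n (β/2) β δ p / (zSq n p + δ) * |u p| ^ (r + 2))) := by
    refine integral_mono_ae i4 ((i3.const_mul _).add (i2.const_mul _)) ?_
    filter_upwards [ae_zSq n (by omega)] with p hp
    show _ ≤ _
    have hp0 : p ≠ 0 := by rintro rfl; simp [zSq] at hp
    have hN := NN_pos n p hp0
    have hzl := psi_z_le n β δ hδ hb0 hb1 p hp0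
    have hψ := psi_nonneg n (β/2) β δ hδ p
    have hU : 0 ≤ |u p| ^ (r + 2) / (r + 2) := by positivity
    set ψ := psi n (β/2) β δ p
    have hLL : LL n (β/2) β δ p ≤ (4 * β * n + 4 * β ^ 2) * (zSq n p / NN n p) -
        (4 * β * (n - 1 - β)) / (zSq n p + δ) := by
      have e1 : (4 * β * n + 4 * β ^ 2) * (zSq n p / NN n p) -
        (4 * β * (n - 1 - β)) / (zSq n p + δ) - LL n (β/2) β δ p =
        8 * β ^ 2 * zSq n p ^ 2 / (NN n p * (zSq n p + δ)) +
          4 * β * (1 + β) * δ / (zSq n p + δ) ^ 2 := by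
        rw [LL]; field_simp; ring
      have e2 : 0 ≤ 8 * β ^ 2 * zSq n p ^ 2 / (NN n p * (zSq n p + δ)) +
          4 * β * (1 + β) * δ / (zSq n p + δ) ^ 2 := by positivity
      linarith
    have h3 : ψ * LL n (β/2) β δ p ≤ (4 * β * n + 4 * β ^ 2) * NN n p ^ (-(1/2) : ℝ) -
        (4 * β * (n - 1 - β)) * (ψ / (zSq n p + δ)) := by
      calc ψ * LL n (β/2) β δ p ≤ ψ * ((4 * β * n + 4 * β ^ 2) * (zSq n p / NN n p) -
        (4 * β * (n - 1 - β)) / (zSq n p + δ)) := mul_le_mul_of_nonneg_left hLL hψ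
        _ = (4 * β * n + 4 * β ^ 2) * (ψ * (zSq n p / NN n p)) -
          (4 * β * (n - 1 - β)) * (ψ / (zSq n p + δ)) := by ring
        _ ≤ _ := by
          have := mul_le_mul_of_nonneg_left hzl (show 0 ≤ 4 * β * n + 4 * β ^ 2 by positivity)
          linarith
    have h4 := mul_le_mul_of_nonneg_right h3 hU
    have e5 : (4 * β * n + 4 * β ^ 2) / (r + 2) * (NN n p ^ (-(1/2) : ℝ) * |u p| ^ (r + 2)) +
        -((4 * β * (n - 1 - β)) / (r + 2)) * (ψ / (zSq n p + δ) * |u p| ^ (r + 2)) =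
        ((4 * β * n + 4 * β ^ 2) * NN n p ^ (-(1/2) : ℝ) -
        (4 * β * (n - 1 - β)) * (ψ / (zSq n p + δ))) * (|u p| ^ (r + 2) / (r + 2)) := by
      field_simp; ring
    rw [e5]
    linarith
  rw [integral_add (i3.const_mul _) (i2.const_mul _), integral_const_mul, integral_const_mul] at h2
  linarith

lemma one_test (n : ℕ) (hn : 2 ≤ n) (u : Hspace n → ℝ) (r δ l : ℝ) (hr : 0 < r)
    (hδ : 0 < δ) (hl : 0 < l)
    (hu : ContDiff ℝ 2 u) (hc : HasCompactSupport u) (h0 : (0 : Hspace n) ∉ tsupport u)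
    (hA : Integrable (fun p => Wt n p * lapH n u p ^ 2))
    (hd : ∀ p ∈ tsupport u, δ ≤ NN n p ^ (1/2 : ℝ)) :
    (r + 1) * ∫ p, (|u p| ^ r * gradH2 n u p) ≤
      l / 2 * (∫ p, Wt n p * lapH n u p ^ 2) + 3 / (2 * l) * (∫ p, wd n δ p * |u p| ^ (2 * r + 2)) := by
  have e1 : ∀ p, psi n 0 0 1 p = 1 := fun p => by simp [psi]
  have h1 := nl_test n (by omega) u r 0 0 1 δ l hr one_pos hδ hl hu hc h0 hA
    (fun p hp hz => by
      obtain ⟨h1, h2, h3⟩ := wd_facts n δ hδ p hz (hd p hp)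
      rw [e1]; nlinarith)
  simpa [e1, LL] using h1

lemma gradH2_bound (n : ℕ) (u : Hspace n → ℝ) (r β δ : ℝ) (hr : 0 < r)
    (hδ : 0 < δ) (hb0 : 0 ≤ β) (hb1 : β ≤ 1)
    (hu : ContDiff ℝ 2 u) (p : Hspace n) (hp : p ≠ 0) :
    gradH2 n (fun p => psi n (β/4) (β/2) δ p * |u p| ^ ((r + 2) / 2)) p ≤
      2 * β ^ 2 * (NN n p ^ (-(1/2) : ℝ) * |u p| ^ (r + 2)) +
      2 * β ^ 2 * (psi n (β/2) β δ p / (zSq n p + δ) * |u p| ^ (r + 2)) +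
      (r + 2) ^ 2 / 2 * (psi n (β/2) β δ p * (|u p| ^ r * gradH2 n u p)) := by
  have hu1 : ContDiff ℝ 1 u := hu.of_le (by norm_num)
  have hud : Differentiable ℝ u := hu1.differentiable one_ne_zero
  have hN := NN_pos n p hp
  have hz := zSq_nonneg n p
  set φ := psi n (β/4) (β/2) δ with hφ
  have hD : ∀ a b, Dh n a b (fun p => φ p * |u p| ^ ((r + 2) / 2)) p =
      φ p * (EE n (β/4) (β/2) δ a b p * |u p| ^ ((r + 2) / 2) +
        (r + 2) / 2 * (|u p| ^ ((r+2)/2 - 2) * u p) * Dh n a b u p) := by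
    intro a b
    have h1 := Dh_psi n (β/4) (β/2) δ hδ a b p hp
    have h2 := Dh_comp n a b u (fun x => |x| ^ ((r + 2) / 2)) _ p (hud p)
      (hasDerivAt_abs_rpow (u p) (p := (r+2)/2) (by linarith))
    have h3 := ((contDiffAt_psi n (β/4) (β/2) δ hδ p hp).differentiableAt one_ne_zero).hasFDerivAt.mul
      ((hasDerivAt_abs_rpow (u p) (p := (r+2)/2) (by linarith)).comp_hasFDerivAt p (hud p).hasFDerivAt)
    have h4 : Dh n a b (fun p => φ p * |u p| ^ ((r + 2) / 2)) p = _ :=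
      congrArg (fun L => L (Vf n a b p)) (HasFDerivAt.fderiv h3)
    rw [h4]
    simp only [Dh, ← hφ] at h1
    simp only [Dh, Function.comp, add_apply, smul_apply, smul_eq_mul, ← hφ]
    rw [h1]
    ring
  have hU2 : (|u p| ^ ((r + 2) / 2)) ^ 2 = |u p| ^ (r + 2) := by
    rw [← rpow_natCast, ← rpow_mul (abs_nonneg _)]; congr 1; push_cast; ring
  have hU3 : (|u p| ^ ((r+2)/2 - 2) * u p) ^ 2 = |u p| ^ r := by
    by_cases hu0 : u p = 0
    · rw [hu0]; simp [zero_rpow hr.ne']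
    · have : 0 < |u p| := abs_pos.mpr hu0
      rw [mul_pow, ← sq_abs (u p), ← rpow_natCast, ← rpow_natCast, ← rpow_mul this.le, ← rpow_add this]
      congr 1; push_cast; ring
  have hφ2 : φ p ^ 2 = psi n (β/2) β δ p := psi_half_sq n β δ hδ p
  have hsq : ∀ a b, (Dh n a b (fun p => φ p * |u p| ^ ((r + 2) / 2)) p) ^ 2 ≤
      psi n (β/2) β δ p * (2 * (|u p| ^ (r + 2) * EE n (β/4) (β/2) δ a b p ^ 2) +
        (r+2)^2/2 * (|u p| ^ r * Dh n a b u p ^ 2)) := by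
    intro a b
    rw [hD, mul_pow, hφ2, ← hU2, ← hU3]
    refine mul_le_mul_of_nonneg_left ?_ (psi_nonneg n _ _ _ hδ p)
    nlinarith [sq_nonneg (EE n (β/4) (β/2) δ a b p * |u p| ^ ((r + 2) / 2) -
        (r + 2) / 2 * (|u p| ^ ((r+2)/2 - 2) * u p) * Dh n a b u p)]
  have hψ := psi_nonneg n (β/2) β δ hδ p
  have hzl := psi_z_le n β δ hδ hb0 hb1 p hp
  set ψ := psi n (β/2) β δ p
  have hE : E2 n (β/4) (β/2) δ p ≤ β ^ 2 * (zSq n p / NN n p + 1 / (zSq n p + δ)) := by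
    have e1 : β ^ 2 * (zSq n p / NN n p + 1 / (zSq n p + δ)) - E2 n (β/4) (β/2) δ p =
      2 * β ^ 2 * zSq n p ^ 2 / (NN n p * (zSq n p + δ)) + β ^ 2 * δ / (zSq n p + δ) ^ 2 := by
      rw [E2]; field_simp; ring
    have e2 : 0 ≤ 2 * β ^ 2 * zSq n p ^ 2 / (NN n p * (zSq n p + δ)) + β ^ 2 * δ / (zSq n p + δ) ^ 2 := by
      positivity
    linarith
  have hU : 0 ≤ |u p| ^ (r + 2) := by positivity
  calc gradH2 n (fun p => φ p * |u p| ^ ((r + 2) / 2)) p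
      ≤ ∑ j : Fin n, (ψ * (2 * (|u p| ^ (r + 2) * EE n (β/4) (β/2) δ (Pi.single j 1) 0 p ^ 2) +
        (r+2)^2/2 * (|u p| ^ r * Dh n (Pi.single j 1) 0 u p ^ 2)) +
        ψ * (2 * (|u p| ^ (r + 2) * EE n (β/4) (β/2) δ 0 (Pi.single j 1) p ^ 2) +
        (r+2)^2/2 * (|u p| ^ r * Dh n 0 (Pi.single j 1) u p ^ 2))) := by
        unfold gradH2
        refine Finset.sum_le_sum fun j _ => ?_
        rw [Xd_Dh, Yd_Dh]
        exact add_le_add (hsq _ _) (hsq _ _)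
    _ = ψ * (2 * |u p| ^ (r + 2) * ∑ j : Fin n, (EE n (β/4) (β/2) δ (Pi.single j 1) 0 p ^ 2 +
          EE n (β/4) (β/2) δ 0 (Pi.single j 1) p ^ 2) + (r+2)^2/2 * (|u p| ^ r * gradH2 n u p)) := by
        simp only [gradH2, Xd_Dh, Yd_Dh, Finset.mul_sum, ← Finset.sum_add_distrib]
        refine Finset.sum_congr rfl fun j _ => ?_
        ring
    _ = ψ * (2 * |u p| ^ (r + 2) * E2 n (β/4) (β/2) δ p + (r+2)^2/2 * (|u p| ^ r * gradH2 n u p)) := by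
        rw [sum_EE_sq n _ _ δ hδ p hp]
    _ ≤ ψ * (2 * |u p| ^ (r + 2) * (β ^ 2 * (zSq n p / NN n p + 1 / (zSq n p + δ))) +
        (r+2)^2/2 * (|u p| ^ r * gradH2 n u p)) := by gcongr
    _ = 2 * β ^ 2 * (ψ * (zSq n p / NN n p) * |u p| ^ (r + 2)) +
      2 * β ^ 2 * (ψ / (zSq n p + δ) * |u p| ^ (r + 2)) +
      (r + 2) ^ 2 / 2 * (ψ * (|u p| ^ r * gradH2 n u p)) := by ring
    _ ≤ _ := by gcongr

lemma sob_step (n : ℕ) (hn : 2 ≤ n) : ∃ S : ℝ, 0 < S ∧ ∀ (u : Hspace n → ℝ) (r β δ : ℝ),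
    r = 2 / ((n:ℝ) - 1) → β = (n:ℝ) / (n + 1) → 0 < δ →
    ContDiff ℝ 2 u → HasCompactSupport u → (0 : Hspace n) ∉ tsupport u →
    (∫ p, wd n δ p * |u p| ^ (2 * r + 2)) ^ ((n:ℝ) / (n + 1)) ≤ S *
      (2 * β ^ 2 * (∫ p, NN n p ^ (-(1/2) : ℝ) * |u p| ^ (r + 2)) +
      2 * β ^ 2 * (∫ p, psi n (β/2) β δ p / (zSq n p + δ) * |u p| ^ (r + 2)) +
      (r + 2) ^ 2 / 2 * (∫ p, psi n (β/2) β δ p * (|u p| ^ r * gradH2 n u p))) := by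
  obtain ⟨S, hS, hsob⟩ := sobolev n (by omega)
  refine ⟨S, hS, ?_⟩
  intro u r β δ hr hβ hδ hu hc h0
  have hn' : (2:ℝ) ≤ n := by exact_mod_cast hn
  have hr0 : 0 < r := by rw [hr]; apply div_pos <;> linarith
  have hb0 : 0 < β := by rw [hβ]; positivity
  have hb1 : β ≤ 1 := by rw [hβ, div_le_one (by positivity)]; linarith
  have hu1 : ContDiff ℝ 1 u := hu.of_le (by norm_num)
  set g : Hspace n → ℝ := fun p => psi n (β/4) (β/2) δ p * |u p| ^ ((r + 2) / 2) with hg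
  have hgs : tsupport g ⊆ tsupport u := by
    refine closure_minimal ?_ (isClosed_tsupport u)
    intro p hp
    by_contra hp'
    exact hp (by simp [hg, image_eq_zero_of_notMem_tsupport hp',
      zero_rpow (show (r + 2) / 2 ≠ 0 by positivity)])
  have hgc : ContDiff ℝ 1 g := by
    refine contDiff_of_ts n g fun p hp => ?_
    have hp0 : p ≠ 0 := by rintro rfl; exact h0 (hgs hp)
    refine (contDiffAt_psi n _ _ _ hδ p hp0).mul ?_
    have : ContDiff ℝ 1 (fun x : ℝ => |x| ^ ((r+2)/2)) := by
      have := contDiff_norm_rpow (E := ℝ) (p := (r+2)/2) (by linarith)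
      simpa using this
    exact (this.comp hu1).contDiffAt
  have hgk : HasCompactSupport g := hc.of_isClosed_subset (isClosed_tsupport _) hgs
  have hg0 : ∀ p, 0 ≤ g p := fun p => mul_nonneg (psi_nonneg n _ _ _ hδ p) (by positivity)
  have h1 := hsob g hgc hgk hg0
  have e1 : ∀ p, g p ^ ((2 * n + 2 : ℝ) / n) = wd n δ p * |u p| ^ (2 * r + 2) := by
    intro p
    have hw := wd_nonneg n δ hδ p
    have hψ2 : psi n (β/4) (β/2) δ p = wd n δ p ^ (β/2) := by
      rw [← psi_eq_wd n (β/2) δ hδ]; congr 1; ring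
    simp only [hg]
    rw [hψ2, mul_rpow (by positivity) (by positivity), ← rpow_mul hw, ← rpow_mul (abs_nonneg _)]
    have x1 : β / 2 * ((2 * n + 2) / n) = 1 := by rw [hβ]; field_simp
    have x2 : (r + 2) / 2 * ((2 * n + 2) / n) = 2 * r + 2 := by
      have : (n:ℝ) - 1 ≠ 0 := by linarith
      rw [hr]; field_simp; ring
    rw [x1, x2, rpow_one]
  simp_rw [e1] at h1
  refine h1.trans (mul_le_mul_of_nonneg_left ?_ hS.le)
  obtain ⟨i1, i2, _⟩ := integ_pack n u r (β/2) β δ hr0 hδ hu hc h0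
  have i3 := integ_NN n u (-(1/2)) (r+2) (by positivity) hu.continuous hc h0
  have i4 : Integrable (fun p => 2 * β ^ 2 * (NN n p ^ (-(1/2) : ℝ) * |u p| ^ (r + 2)) +
      2 * β ^ 2 * (psi n (β/2) β δ p / (zSq n p + δ) * |u p| ^ (r + 2))) :=
    (i3.const_mul _).add (i2.const_mul _)
  rw [← integral_const_mul, ← integral_const_mul, ← integral_const_mul, ← integral_add
    (i3.const_mul _) (i2.const_mul _), ← integral_add i4 (i1.const_mul _)]
  have ig : Integrable (gradH2 n g) :=
    (integ_of n u _ hc h0 (fun p _ => (continuous_gradH2 n g hgc).continuousAt)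
      (fun p hp => gradH2_off n g p (fun h => hp (hgs h)))).2.2
  refine integral_mono_ae ig (i4.add (i1.const_mul _)) ?_
  filter_upwards [ae_zSq n (by omega)] with p hp
  have hp0 : p ≠ 0 := by rintro rfl; simp [zSq] at hp
  exact gradH2_bound n u r β δ hr0 hδ hb0.le hb1 hu p hp0

set_option maxHeartbeats 1000000 in
theorem s0_est (n : ℕ) (hn : 2 ≤ n) : ∃ C : ℝ, 0 < C ∧ ∀ (u : Hspace n → ℝ) (r δ : ℝ),
    r = 2 / ((n:ℝ) - 1) → 0 < δ →
    ContDiff ℝ 2 u → HasCompactSupport u → (0 : Hspace n) ∉ tsupport u →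
    Integrable (fun p => Wt n p * lapH n u p ^ 2) →
    (∀ p ∈ tsupport u, δ ≤ NN n p ^ (1/2 : ℝ)) →
    (∫ p, wd n δ p * |u p| ^ (2 * r + 2)) ^ (((n:ℝ) - 1) / (n + 1)) ≤
      C * ∫ p, Wt n p * lapH n u p ^ 2 := by
  obtain ⟨S, hS, hsob⟩ := sob_step n hn
  have hn' : (2:ℝ) ≤ n := by exact_mod_cast hn
  set r : ℝ := 2 / ((n:ℝ) - 1) with hr
  set β : ℝ := (n:ℝ) / (n + 1) with hβ
  have hr0 : 0 < r := by rw [hr]; apply div_pos <;> linarith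
  have hb0 : 0 < β := by rw [hβ]; positivity
  have hb1 : β < 1 := by rw [hβ, div_lt_one (by positivity)]; linarith
  set c1 : ℝ := (4 * β * n + 4 * β ^ 2) / (r + 2) with hc1
  set c2 : ℝ := (4 * β * (n - 1 - β)) / (r + 2) with hc2
  have hc1p : 0 < c1 := by positivity
  have hc2p : 0 < c2 := by
    have : 0 < (n:ℝ) - 1 - β := by linarith
    positivity
  set M : ℝ := 1 + c1 * ((r + 2) ^ 2 / 4) with hM
  have hMp : 0 < M := by positivity
  set K : ℝ := S * (2 * β ^ 2 * ((r+2)^2/4) + 2 * β ^ 2 * (M / c2) + (r+2)^2/2 * M) with hK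
  have hKp : 0 < K := by positivity
  refine ⟨3 * K ^ 2, by positivity, ?_⟩
  intro u r' δ hr' hδ hu hc h0 hA hd
  obtain rfl : r' = r := hr'
  set A := ∫ p, Wt n p * lapH n u p ^ 2 with hAdef
  set F := ∫ p, wd n δ p * |u p| ^ (2 * r + 2) with hFdef
  have hA0 : 0 ≤ A := integral_nonneg fun p => mul_nonneg (Wt_nonneg n p) (sq_nonneg _)
  have hF0 : 0 ≤ F := integral_nonneg fun p => mul_nonneg (wd_nonneg n δ hδ p) (by positivity)
  have key : ∀ l : ℝ, 0 < l → F ^ β ≤ K * (l / 2 * A + 3 / (2 * l) * F) := by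
    intro l hl
    have t0 := hsob u r β δ rfl rfl hδ hu hc h0
    have t1 := one_test n hn u r δ l hr0 hδ hl hu hc h0 hA hd
    have t2 := hardy n hn u r hr0 hu hc h0
    have t3 := psi_test n hn u r β δ l hr0 hδ hb0.le hb1.le hl hu hc h0 hA hd
    rw [← hc1, ← hc2] at t3
    have p1 : 0 ≤ ∫ p, psi n (β/2) β δ p / (zSq n p + δ) * |u p| ^ (r + 2) :=
      integral_nonneg fun p => by
        have := psi_nonneg n (β/2) β δ hδ p
        have := zSq_nonneg n p
        positivity
    have p2 : 0 ≤ ∫ p, psi n (β/2) β δ p * (|u p| ^ r * gradH2 n u p) :=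
      integral_nonneg fun p => by
        have := psi_nonneg n (β/2) β δ hδ p
        have := gradH2_nonneg n u p
        positivity
    have p3 : 0 ≤ ∫ p, |u p| ^ r * gradH2 n u p :=
      integral_nonneg fun p => by
        have := gradH2_nonneg n u p
        positivity
    rw [← hAdef, ← hFdef] at t1 t3
    rw [← hFdef] at t0
    set H1 := ∫ p, psi n (β/2) β δ p / (zSq n p + δ) * |u p| ^ (r + 2)
    set I1 := ∫ p, psi n (β/2) β δ p * (|u p| ^ r * gradH2 n u p)
    set I0 := ∫ p, |u p| ^ r * gradH2 n u p
    set H0 := ∫ p, NN n p ^ (-(1/2) : ℝ) * |u p| ^ (r + 2)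
    set X := l / 2 * A + 3 / (2 * l) * F
    have q0 : I0 ≤ X := by nlinarith
    have q1 : H0 ≤ (r+2)^2/4 * X :=
      t2.trans (mul_le_mul_of_nonneg_left q0 (by positivity))
    have q2 : X + c1 * H0 ≤ M * X := by
      have := mul_le_mul_of_nonneg_left q1 hc1p.le
      rw [hM]; linarith
    have q3 : I1 ≤ M * X := by
      have : 0 ≤ c2 * H1 := by positivity
      nlinarith
    have q4 : H1 ≤ M / c2 * X := by
      have : 0 ≤ (r + 1) * I1 := by positivity
      rw [div_mul_eq_mul_div, le_div_iff₀ hc2p]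
      linarith
    refine t0.trans ?_
    rw [hK, mul_assoc S]
    refine mul_le_mul_of_nonneg_left ?_ hS.le
    have s1 := mul_le_mul_of_nonneg_left q1 (show 0 ≤ 2 * β ^ 2 by positivity)
    have s2 := mul_le_mul_of_nonneg_left q4 (show 0 ≤ 2 * β ^ 2 by positivity)
    have s3 := mul_le_mul_of_nonneg_left q3 (show 0 ≤ (r+2)^2/2 by positivity)
    linarith
  rcases hF0.eq_or_lt with hF | hF
  · rw [← hF, zero_rpow]
    · positivity
    · have : 0 < ((n:ℝ) - 1) / (n + 1) := by apply div_pos <;> linarith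
      exact this.ne'
  · have hl : 0 < 3 * K * F ^ (1 - β) := by positivity
    have h1 := key _ hl
    have hFb : F = F ^ (1 - β) * F ^ β := by rw [← rpow_add hF]; simp
    have hFa : F ^ β = F ^ (1 - β) * F ^ (((n:ℝ) - 1) / (n + 1)) := by
      rw [← rpow_add hF]; congr 1; rw [hβ]; field_simp; ring
    have e1 : K * (3 / (2 * (3 * K * F ^ (1 - β))) * F) = F ^ β / 2 := by
      nth_rewrite 2 [hFb]
      have : F ^ (1 - β) ≠ 0 := by positivity
      field_simp
    have h2 : F ^ β / 2 ≤ K * (3 * K * F ^ (1 - β) / 2 * A) := by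
      rw [mul_add, e1] at h1; linarith
    rw [hFa] at h2
    have hpos : 0 < F ^ (1 - β) := by positivity
    have h3 : F ^ (1 - β) * F ^ (((n:ℝ) - 1) / (n + 1)) ≤ F ^ (1 - β) * (3 * K ^ 2 * A) := by
      have e2 : K * (3 * K * F ^ (1 - β) / 2 * A) = F ^ (1 - β) * (3 * K ^ 2 * A) / 2 := by ring
      rw [e2] at h2
      linarith only [h2]
    exact le_of_mul_le_mul_left h3 hpos

lemma meas_Wt (n : ℕ) : Measurable (Wt n) := by
  have h1 := (contDiff_NN n (k := 1)).continuous.measurable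
  have h2 := (contDiff_zSq n (k := 1)).continuous.measurable
  exact (h1.pow_const _).div h2

lemma ts_lower (n : ℕ) (u : Hspace n → ℝ) (hc : HasCompactSupport u)
    (h0 : (0 : Hspace n) ∉ tsupport u) :
    ∃ η : ℝ, 0 < η ∧ ∀ p ∈ tsupport u, η ≤ NN n p ^ (1/2 : ℝ) := by
  rcases (tsupport u).eq_empty_or_nonempty with h | h
  · exact ⟨1, one_pos, by simp [h]⟩
  · have hcont : ContinuousOn (fun p => NN n p ^ (1/2 : ℝ)) (tsupport u) :=
      ((contDiff_NN n (k := 1)).continuous.rpow_const (fun _ => Or.inr (by norm_num))).continuousOn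
    obtain ⟨q, hq, hm⟩ := IsCompact.exists_isMinOn hc h hcont
    have hq0 : q ≠ 0 := by rintro rfl; exact h0 hq
    exact ⟨_, rpow_pos_of_pos (NN_pos n q hq0) _, fun p hp => hm hp⟩

theorem s0_full (n : ℕ) (hn : 2 ≤ n) : ∃ C : ℝ, 0 < C ∧ ∀ (u : Hspace n → ℝ) (r : ℝ),
    r = 2 / ((n:ℝ) - 1) →
    ContDiff ℝ 2 u → HasCompactSupport u → (0 : Hspace n) ∉ tsupport u →
    Integrable (fun p => Wt n p * lapH n u p ^ 2) →
    ∫⁻ p, ENNReal.ofReal (Wt n p * |u p| ^ (2 * r + 2)) ≤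
      ENNReal.ofReal ((C * ∫ p, Wt n p * lapH n u p ^ 2) ^ (((n:ℝ) + 1) / (n - 1))) := by
  obtain ⟨C, hC, h⟩ := s0_est n hn
  refine ⟨C, hC, ?_⟩
  intro u r hr hu hc h0 hA
  have hn' : (2:ℝ) ≤ n := by exact_mod_cast hn
  have hr0 : 0 < r := by rw [hr]; apply div_pos <;> linarith
  obtain ⟨η, hη, hlow⟩ := ts_lower n u hc h0
  set A := ∫ p, Wt n p * lapH n u p ^ 2 with hAdef
  have hA0 : 0 ≤ A := integral_nonneg fun p => mul_nonneg (Wt_nonneg n p) (sq_nonneg _)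
  set d : ℕ → ℝ := fun k => η / ((k:ℝ) + 1) with hd
  have hdpos : ∀ k, 0 < d k := fun k => by simp only [hd]; positivity
  have hdle : ∀ k, d k ≤ η := fun k => by
    simp only [hd]
    exact div_le_self hη.le (by have : (0:ℝ) ≤ k := Nat.cast_nonneg k
                                linarith)
  have hdlim : Filter.Tendsto d Filter.atTop (nhds 0) := by
    have := (tendsto_one_div_add_atTop_nhds_zero_nat (𝕜 := ℝ)).const_mul η
    simpa [hd, div_eq_mul_inv] using this
  have hIntg : ∀ k, Integrable (fun p => wd n (d k) p * |u p| ^ (2 * r + 2)) := fun k =>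
    (integ_pack n u r 0 0 (d k) hr0 (hdpos k) hu hc h0).2.2
  have hb : ∀ k, ∫⁻ p, ENNReal.ofReal (wd n (d k) p * |u p| ^ (2 * r + 2)) ≤
      ENNReal.ofReal ((C * A) ^ (((n:ℝ) + 1) / (n - 1))) := by
    intro k
    have h1 := h u r (d k) hr (hdpos k) hu hc h0 hA (fun p hp => (hdle k).trans (hlow p hp))
    have hnn : ∀ p, 0 ≤ wd n (d k) p * |u p| ^ (2 * r + 2) := fun p =>
      mul_nonneg (wd_nonneg n _ (hdpos k) p) (by positivity)
    rw [← ofReal_integral_eq_lintegral_ofReal (hIntg k) (Filter.Eventually.of_forall hnn)]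
    refine ENNReal.ofReal_le_ofReal ?_
    have hF : 0 ≤ ∫ p, wd n (d k) p * |u p| ^ (2 * r + 2) := integral_nonneg hnn
    have h2 := rpow_le_rpow (by positivity) h1
      (show 0 ≤ ((n:ℝ) + 1) / (n - 1) by apply div_nonneg <;> linarith)
    rw [← rpow_mul hF] at h2
    have : ((n:ℝ) - 1) / (n + 1) * ((n + 1) / (n - 1)) = 1 := by
      have : (n:ℝ) - 1 ≠ 0 := by linarith
      field_simp
    rwa [this, rpow_one] at h2
  have hlim : ∀ᵐ p : Hspace n, ENNReal.ofReal (Wt n p * |u p| ^ (2 * r + 2)) =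
      Filter.liminf (fun k => ENNReal.ofReal (wd n (d k) p * |u p| ^ (2 * r + 2))) Filter.atTop := by
    filter_upwards [ae_zSq n (by omega)] with p hp
    refine (Filter.Tendsto.liminf_eq ?_).symm
    refine ENNReal.tendsto_ofReal (Filter.Tendsto.mul_const _ ?_)
    have : Filter.Tendsto (fun k => zSq n p + d k) Filter.atTop (nhds (zSq n p)) := by
      simpa using hdlim.const_add (zSq n p)
    exact Filter.Tendsto.div tendsto_const_nhds this hp.ne'
  rw [lintegral_congr_ae hlim]
  refine (lintegral_liminf_le' fun k => (hIntg k).aestronglyMeasurable.aemeasurable.ennreal_ofReal).trans ?_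
  refine (Filter.liminf_le_liminf (Filter.Eventually.of_forall hb)).trans ?_
  simp

lemma pt_id (z N a s q q0 : ℝ) (hz : 0 < z) (hN : 0 < N) (ha : 0 ≤ a) (hq : 0 < q)
    (hs0 : 0 ≤ s) (hs2 : s ≤ 2)
    (hqe : q = s + q0 * (1 - s / 2)) :
    √z ^ (2 * s - 2) / (N ^ ((4:ℝ)⁻¹)) ^ (4 * s - 2) * a ^ q ≤
      (z * N ^ (-(3/2) : ℝ) * a ^ 2) ^ (s / 2) * (N ^ (1/2 : ℝ) / z * a ^ q0) ^ (1 - s / 2) := by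
  rcases ha.eq_or_lt with h | h
  · rw [← h, zero_rpow hq.ne', mul_zero]; positivity
  · refine le_of_eq ?_
    have e1 : √z = z ^ (1/2 : ℝ) := sqrt_eq_rpow z
    rw [e1, ← rpow_mul hz.le, ← rpow_mul hN.le]
    rw [← rpow_natCast a 2, mul_rpow (by positivity) (by positivity), mul_rpow hz.le (by positivity),
      mul_rpow (by positivity) (by positivity), div_rpow (by positivity) hz.le, ← rpow_mul hN.le,
      ← rpow_mul ha, ← rpow_mul hN.le, ← rpow_mul ha]
    rw [div_eq_mul_inv (_ ^ _) (N ^ _), div_eq_mul_inv (_ ^ _) (z ^ _), ← rpow_neg hN.le, ← rpow_neg hz.le]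
    have x1 : z ^ (1 / 2 * (2 * s - 2)) = z ^ (s/2) * z ^ (-(1 - s/2)) := by
      rw [← rpow_add hz]; congr 1; ring
    have x2 : N ^ (-((4:ℝ)⁻¹ * (4 * s - 2))) = N ^ (-(3/2) * (s/2)) * N ^ (1/2 * (1 - s/2)) := by
      rw [← rpow_add hN]; congr 1; ring
    have x3 : a ^ q = a ^ (((2:ℕ):ℝ) * (s/2)) * a ^ (q0 * (1 - s/2)) := by
      rw [← rpow_add h]; congr 1; rw [hqe]; push_cast; ring
    rw [x1, x2, x3]; ring

lemma rho_eq (n : ℕ) (p : Hspace n) : rho n p = NN n p ^ ((4:ℝ)⁻¹) := rfl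

lemma rho_sq (n : ℕ) (p : Hspace n) : rho n p ^ 2 = NN n p ^ (1/2 : ℝ) := by
  rw [rho_eq, ← rpow_natCast, ← rpow_mul (NN_nonneg n p)]; norm_num

/-- Rellich–Sobolev type inequality on a metric ball `B = {ρ < R}` in ℍⁿ
(with `Q = 2n + 2 > 4` and `0 ≤ s ≤ 2`): there exists `C > 0` such that
`∫_B (ρ²/|z|²) |Δ_ℍ φ|² ≥ C (∫_B (|z|^{2s−2}/ρ^{4s−2}) |φ|^{2(Q−2s)/(Q−4)})^{(Q−4)/(Q−2s)}`
for all `φ ∈ C_c^∞` supported in `B \ {0}`. -/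
theorem heisenberg_rellich_sobolev (n : ℕ) (hn : 2 ≤ n) (Q s R : ℝ)
    (hQ : Q = 2 * n + 2) (hs0 : 0 ≤ s) (hs2 : s ≤ 2) (hR : 0 < R) :
    ∃ C : ℝ, 0 < C ∧ ∀ φ : Hspace n → ℝ, ContDiff ℝ (⊤ : ℕ∞) φ → HasCompactSupport φ →
      tsupport φ ⊆ {p : Hspace n | rho n p < R} \ {0} →
      (∫⁻ p in {p : Hspace n | rho n p < R},
          ENNReal.ofReal ((rho n p ^ 2 / zSq n p) * (lapH n φ p) ^ 2)) ≥
        ENNReal.ofReal C *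
          (∫⁻ p in {p : Hspace n | rho n p < R},
              ENNReal.ofReal ((Real.sqrt (zSq n p) ^ (2 * s - 2) / rho n p ^ (4 * s - 2)) *
                |φ p| ^ (2 * (Q - 2 * s) / (Q - 4)))) ^ ((Q - 4) / (Q - 2 * s)) := by
  have hn' : (2:ℝ) ≤ n := by exact_mod_cast hn
  obtain ⟨C0, hC0, hfull⟩ := s0_full n hn
  set D : ℝ := max C0 (1 / (2 * n - 2) ^ 2) with hD
  have hDp : 0 < D := lt_max_of_lt_left hC0
  have hn2 : (0:ℝ) < 2 * n - 2 := by linarith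
  have hQ4 : Q - 4 = 2 * n - 2 := by rw [hQ]; ring
  have hγ : 0 < Q - 2 * s := by rw [hQ]; linarith
  refine ⟨D⁻¹, inv_pos.2 hDp, ?_⟩
  intro φ hφ hc hsup
  have hu : ContDiff ℝ 2 φ := contDiff_infty.1 hφ 2
  have h0 : (0 : Hspace n) ∉ tsupport φ := fun h => (hsup h).2 rfl
  set B : Set (Hspace n) := {p | rho n p < R} with hB
  have hL : ∫⁻ p in B, ENNReal.ofReal ((rho n p ^ 2 / zSq n p) * (lapH n φ p) ^ 2) =
      ∫⁻ p, ENNReal.ofReal (Wt n p * lapH n φ p ^ 2) := by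
    simp_rw [rho_sq]
    refine setLIntegral_eq_of_support_subset ?_
    intro p hp
    by_contra hpB
    refine hp ?_
    have : p ∉ tsupport φ := fun h => hpB (hsup h).1
    simp [lapH_off n φ p this]
  rw [hL, ge_iff_le]
  have hmeas : Measurable (fun p => Wt n p * lapH n φ p ^ 2) :=
    (meas_Wt n).mul ((continuous_lapH n φ hu).measurable.pow_const _)
  have hnn : ∀ p, 0 ≤ Wt n p * lapH n φ p ^ 2 :=
    fun p => mul_nonneg (Wt_nonneg n p) (sq_nonneg _)
  by_cases htop : ∫⁻ p, ENNReal.ofReal (Wt n p * lapH n φ p ^ 2) = ⊤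
  · rw [htop]; exact le_top
  have hA : Integrable (fun p => Wt n p * lapH n φ p ^ 2) :=
    (lintegral_ofReal_ne_top_iff_integrable hmeas.aestronglyMeasurable
      (Filter.Eventually.of_forall hnn)).1 htop
  rw [← ofReal_integral_eq_lintegral_ofReal hA (Filter.Eventually.of_forall hnn)]
  obtain ⟨ri, rl⟩ := rellich n hn φ hu hc h0 hA
  have hs := hfull φ _ rfl hu hc h0 hA
  set A := ∫ p, Wt n p * lapH n φ p ^ 2 with hAdef
  have hA0 : 0 ≤ A := integral_nonneg hnn
  set q0 : ℝ := 2 * (2 / ((n:ℝ) - 1)) + 2 with hq0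
  have hn1 : (0:ℝ) < n - 1 := by linarith
  have b1 : ∫⁻ p, ENNReal.ofReal (zSq n p * NN n p ^ (-(3/2):ℝ) * φ p ^ 2) ≤ ENNReal.ofReal (D * A) := by
    rw [← ofReal_integral_eq_lintegral_ofReal ri (Filter.Eventually.of_forall fun p =>
      mul_nonneg (mul_nonneg (zSq_nonneg n p) (rpow_nonneg (NN_nonneg n p) _)) (sq_nonneg _))]
    refine ENNReal.ofReal_le_ofReal ?_
    have h1 : ∫ p, zSq n p * NN n p ^ (-(3/2):ℝ) * φ p ^ 2 ≤ 1 / (2 * n - 2) ^ 2 * A := by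
      rw [div_mul_eq_mul_div, one_mul, le_div_iff₀ (by positivity)]; linarith
    exact h1.trans (mul_le_mul_of_nonneg_right (le_max_right _ _) hA0)
  have b2 : ∫⁻ p, ENNReal.ofReal (Wt n p * |φ p| ^ q0) ≤
      ENNReal.ofReal (D * A) ^ (((n:ℝ) + 1) / (n - 1)) := by
    refine hs.trans ?_
    rw [ENNReal.ofReal_rpow_of_nonneg (by positivity) (by positivity)]
    exact ENNReal.ofReal_le_ofReal (rpow_le_rpow (by positivity)
      (mul_le_mul_of_nonneg_right (le_max_left _ _) hA0) (by positivity))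
  set q : ℝ := 2 * (Q - 2 * s) / (Q - 4) with hq
  have hqp : 0 < q := by rw [hq, hQ4]; positivity
  have hqe : q = s + q0 * (1 - s / 2) := by
    rw [hq, hq0, hQ4, hQ]
    have : (2 * (n:ℝ) - 2) = 2 * (n - 1) := by ring
    rw [this]; field_simp; ring
  have b3 : ∫⁻ p in B, ENNReal.ofReal ((√(zSq n p) ^ (2 * s - 2) / rho n p ^ (4 * s - 2)) * |φ p| ^ q) ≤
      ENNReal.ofReal (D * A) ^ ((Q - 2 * s) / (Q - 4)) := by
    calc _ ≤ ∫⁻ p, ENNReal.ofReal ((√(zSq n p) ^ (2 * s - 2) / rho n p ^ (4 * s - 2)) * |φ p| ^ q) :=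
          setLIntegral_le_lintegral _ _
      _ ≤ ∫⁻ p, ENNReal.ofReal (zSq n p * NN n p ^ (-(3/2):ℝ) * φ p ^ 2) ^ (s / 2) *
            ENNReal.ofReal (Wt n p * |φ p| ^ q0) ^ (1 - s / 2) := by
          refine lintegral_mono_ae ?_
          filter_upwards [ae_zSq n (by omega)] with p hp
          have hN := NN_of_z n p hp
          have hw := Wt_nonneg n p
          rw [ENNReal.ofReal_rpow_of_nonneg (by positivity) (by linarith),
            ENNReal.ofReal_rpow_of_nonneg (by positivity) (by linarith),
            ← ENNReal.ofReal_mul (by positivity)]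
          refine ENNReal.ofReal_le_ofReal ?_
          have := pt_id (zSq n p) (NN n p) |φ p| s q q0 hp hN (abs_nonneg _) hqp hs0 hs2 hqe
          rwa [sq_abs] at this
      _ ≤ (∫⁻ p, ENNReal.ofReal (zSq n p * NN n p ^ (-(3/2):ℝ) * φ p ^ 2)) ^ (s / 2) *
            (∫⁻ p, ENNReal.ofReal (Wt n p * |φ p| ^ q0)) ^ (1 - s / 2) := by
          refine ENNReal.lintegral_mul_norm_pow_le ri.aestronglyMeasurable.aemeasurable.ennreal_ofReal
            ?_ (by linarith) (by linarith) (by ring)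
          exact ((meas_Wt n).mul (hu.continuous.abs.measurable.pow_const _)).ennreal_ofReal.aemeasurable
      _ ≤ ENNReal.ofReal (D * A) ^ (s / 2) *
            (ENNReal.ofReal (D * A) ^ (((n:ℝ) + 1) / (n - 1))) ^ (1 - s / 2) :=
          mul_le_mul' (ENNReal.rpow_le_rpow b1 (by linarith)) (ENNReal.rpow_le_rpow b2 (by linarith))
      _ = _ := by
          have h1 : 0 ≤ ((n:ℝ) + 1) / (n - 1) := by positivity
          rw [← ENNReal.rpow_mul, ← ENNReal.rpow_add_of_nonneg _ _ (by linarith)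
            (mul_nonneg h1 (by linarith))]
          congr 1
          rw [hQ4, hQ]
          have : (2 * (n:ℝ) - 2) = 2 * (n - 1) := by ring
          rw [this]; field_simp; ring
  have b4 := ENNReal.rpow_le_rpow b3 (show 0 ≤ (Q - 4) / (Q - 2 * s) by rw [hQ4]; positivity)
  rw [← ENNReal.rpow_mul, div_mul_div_cancel₀ (by rw [hQ4]; exact hn2.ne'), div_self hγ.ne',
    ENNReal.rpow_one] at b4
  refine (mul_le_mul_right b4 _).trans ?_
  rw [← ENNReal.ofReal_mul (by positivity), inv_mul_cancel_left₀ hDp.ne']
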